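/- arXiv:0910.3266 — 4 statements merged into one kernel-verified Lean document; each statement's English description precedes it below -/
import Mathlib

section
/- For every integer d ≥ 1, every α ∈ (0,2) and every x ∈ ℝ^d with x_1 > 0, the principal value limit defining Δ^{α/2} w_{α/2}(x) exists and equals 0; that is, lim_{ε↓0} ∫_{{y ∈ ℝ^d : |y−x|>ε}} (w_{α/2}(y) − w_{α/2}(x)) |x−y|^{−d−α} dy = 0. -/
open MeasureTheory Filter Set

/-- The constant 𝒜(d, -α) = α 2^{α-1} π^{-d/2} Γ((d+α)/2) Γ(1-α/2)^{-1}. -/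
noncomputable def fracConst (d : ℕ) (α : ℝ) : ℝ :=
  α * 2 ^ (α - 1) * Real.pi ^ (-(d : ℝ) / 2) *
    Real.Gamma (((d : ℝ) + α) / 2) / Real.Gamma (1 - α / 2)

/-- The truncated-at-ε integral ∫_{|y-x|>ε} (u(y)-u(x)) |x-y|^{-d-α} dy whose limit
as ε ↓ 0 is the principal value integral defining the fractional Laplacian
(up to the constant `fracConst`). -/
noncomputable def pvInt (d : ℕ) (α : ℝ) (u : EuclideanSpace ℝ (Fin d) → ℝ)
    (x : EuclideanSpace ℝ (Fin d)) (ε : ℝ) : ℝ :=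
  ∫ y in {y : EuclideanSpace ℝ (Fin d) | ε < dist y x},
    (u y - u x) / dist x y ^ ((d : ℝ) + α)

open scoped Topology

/-- The second difference at `1` with step `s` of the function `t ↦ (t⁺) ^ p`. -/
noncomputable def posPowSecondDiff (p s : ℝ) : ℝ :=
  (max (1 + s) 0) ^ p + (max (1 - s) 0) ^ p - 2

lemma posPowSecondDiff_neg (p s : ℝ) : posPowSecondDiff p (-s) = posPowSecondDiff p s := by
  simp only [posPowSecondDiff, sub_neg_eq_add, ← sub_eq_add_neg]
  ring

lemma posPowSecondDiff_abs (p s : ℝ) : posPowSecondDiff p |s| = posPowSecondDiff p s := by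
  rcases abs_choice s with h | h <;> rw [h]
  exact posPowSecondDiff_neg p s

lemma continuous_posPowSecondDiff {p : ℝ} (hp : 0 < p) : Continuous (posPowSecondDiff p) := by
  unfold posPowSecondDiff
  have h : ∀ x : ℝ, x ≠ 0 ∨ 0 ≤ p := fun _ => Or.inr hp.le
  exact (((continuous_const.add continuous_id).max continuous_const).rpow_const (fun _ => h _)).add
    (((continuous_const.sub continuous_id).max continuous_const).rpow_const (fun _ => h _)) |>.sub
    continuous_const

lemma abs_posPowSecondDiff_le_of_abs_le_one {p s : ℝ} (hp : 0 < p) (hp1 : p < 1) (hs : |s| ≤ 1) :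
    |posPowSecondDiff p s| ≤ 2 * s ^ 2 := by
  obtain ⟨h1, h2⟩ := abs_le.1 hs
  have e1 : max (1 + s) 0 = 1 + s := max_eq_left (by linarith)
  have e2 : max (1 - s) 0 = 1 - s := max_eq_left (by linarith)
  have u1 := rpow_one_add_le_one_add_mul_self h1 hp.le hp1.le
  have u2 := rpow_one_add_le_one_add_mul_self (s := -s) (by linarith) hp.le hp1.le
  rw [← sub_eq_add_neg] at u2
  have hprod : 1 - s ^ 2 ≤ (1 + s) ^ p * (1 - s) ^ p := by
    rw [← Real.mul_rpow (by linarith) (by linarith)]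
    have : (1 + s) * (1 - s) = 1 - s ^ 2 := by ring
    rw [this]
    exact Real.self_le_rpow_of_le_one (by nlinarith) (by nlinarith) hp1.le
  have v1 : 0 ≤ (1 + s) ^ p := Real.rpow_nonneg (by linarith) _
  have v2 : 0 ≤ (1 - s) ^ p := Real.rpow_nonneg (by linarith) _
  unfold posPowSecondDiff
  rw [e1, e2, abs_le]
  constructor
  · have h3 : 0 ≤ 1 - s ^ 2 := by nlinarith
    nlinarith [sq_nonneg ((1 + s) ^ p - (1 - s) ^ p)]
  · nlinarith

lemma abs_posPowSecondDiff_le_of_one_le_abs {p s : ℝ} (hp : 0 < p) (hp1 : p < 1) (hs : 1 ≤ |s|) :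
    |posPowSecondDiff p s| ≤ 2 * |s| ^ p := by
  rw [← posPowSecondDiff_abs]
  set t := |s|
  have e1 : max (1 + t) 0 = 1 + t := max_eq_left (by linarith)
  have e2 : max (1 - t) 0 = 0 := max_eq_right (by linarith)
  have h1 : 1 ≤ t ^ p := Real.one_le_rpow hs hp.le
  have h2 : (1 + t) ^ p ≤ (2 * t) ^ p :=
    Real.rpow_le_rpow (by linarith) (by linarith) hp.le
  rw [Real.mul_rpow (by norm_num) (by linarith)] at h2
  have h3 : (2 : ℝ) ^ p ≤ 2 := Real.rpow_le_self_of_one_le (by norm_num) hp1.le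
  have h4 : 0 ≤ (1 + t) ^ p := Real.rpow_nonneg (by linarith) _
  unfold posPowSecondDiff
  rw [e1, e2, Real.zero_rpow hp.ne', abs_le]
  constructor <;> nlinarith

lemma abs_posPowSecondDiff_le_min {p s r : ℝ} (hp : 0 < p) (hp1 : p < 1) (hsr : |s| ≤ r) :
    |posPowSecondDiff p s| ≤ 2 * min (r ^ (2 : ℝ)) (r ^ p) := by
  have h0 := abs_nonneg s
  suffices |posPowSecondDiff p s| ≤ 2 * min (|s| ^ (2 : ℝ)) (|s| ^ p) from
    this.trans (by gcongr)
  rcases le_total |s| 1 with h | h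
  · have := abs_posPowSecondDiff_le_of_abs_le_one hp hp1 h
    rcases h0.eq_or_lt with h00 | h00
    · rw [← h00, Real.zero_rpow two_ne_zero, Real.zero_rpow hp.ne', min_self]
      rw [← sq_abs, ← h00] at this
      simpa using this
    rw [min_eq_left (Real.rpow_le_rpow_of_exponent_ge h00 h (by linarith)), Real.rpow_two, sq_abs]
    exact this
  · rw [min_eq_right (Real.rpow_le_rpow_of_exponent_le h (by linarith))]
    exact abs_posPowSecondDiff_le_of_one_le_abs hp hp1 h

lemma integrableOn_min_rpow_mul_rpow {p : ℝ} (hp : 0 < p) (hp1 : p < 1) {a : ℝ} (ha : 0 < a) :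
    IntegrableOn (fun r : ℝ => min ((r / a) ^ (2 : ℝ)) ((r / a) ^ p) * r ^ (-1 - 2 * p))
      (Ioi 0) := by
  have hmeas : Measurable
      (fun r : ℝ => min ((r / a) ^ (2 : ℝ)) ((r / a) ^ p) * r ^ (-1 - 2 * p)) := by fun_prop
  have hnonneg : ∀ r : ℝ, 0 < r →
      0 ≤ min ((r / a) ^ (2 : ℝ)) ((r / a) ^ p) * r ^ (-1 - 2 * p) := fun r hr => by positivity
  rw [← Ioc_union_Ioi_eq_Ioi zero_le_one]
  refine IntegrableOn.union ?_ ?_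
  · have h : IntegrableOn (fun r : ℝ => (a ^ (2 : ℝ))⁻¹ * r ^ (1 - 2 * p)) (Ioc 0 1) :=
      ((intervalIntegrable_iff_integrableOn_Ioc_of_le zero_le_one).1
        (intervalIntegral.intervalIntegrable_rpow' (by linarith))).const_mul _
    refine h.mono' hmeas.aestronglyMeasurable ?_
    filter_upwards [ae_restrict_mem measurableSet_Ioc] with r hr
    rw [Real.norm_of_nonneg (hnonneg r hr.1)]
    calc _ ≤ (r / a) ^ (2 : ℝ) * r ^ (-1 - 2 * p) := by
          have := hr.1
          gcongr
          exact min_le_left _ _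
      _ = _ := by
          rw [Real.div_rpow hr.1.le ha.le, div_eq_inv_mul, mul_assoc, ← Real.rpow_add hr.1]
          ring_nf
  · have h : IntegrableOn (fun r : ℝ => (a ^ p)⁻¹ * r ^ (-1 - p)) (Ioi 1) :=
      (integrableOn_Ioi_rpow_of_lt (by linarith) one_pos).const_mul _
    refine h.mono' hmeas.aestronglyMeasurable ?_
    filter_upwards [ae_restrict_mem measurableSet_Ioi] with r hr
    have hr0 : 0 < r := one_pos.trans hr
    rw [Real.norm_of_nonneg (hnonneg r hr0)]
    calc _ ≤ (r / a) ^ p * r ^ (-1 - 2 * p) := by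
          gcongr
          exact min_le_right _ _
      _ = _ := by
          rw [Real.div_rpow hr0.le ha.le, div_eq_inv_mul, mul_assoc, ← Real.rpow_add hr0]
          ring_nf

lemma integrableOn_posPowSecondDiff {p : ℝ} (hp : 0 < p) (hp1 : p < 1) :
    IntegrableOn (fun s => posPowSecondDiff p s * s ^ (-1 - 2 * p)) (Ioi 0) := by
  refine ((integrableOn_min_rpow_mul_rpow hp hp1 one_pos).const_mul 2).mono'
    ((continuous_posPowSecondDiff hp).measurable.mul (by fun_prop)).aestronglyMeasurable ?_
  filter_upwards [ae_restrict_mem measurableSet_Ioi] with s hs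
  have hs0 : 0 < s := hs
  rw [norm_mul, Real.norm_of_nonneg (Real.rpow_nonneg hs0.le _), div_one, ← mul_assoc]
  gcongr
  exact abs_posPowSecondDiff_le_min hp hp1 (abs_of_pos hs0).le

/-- The integrand of the backward increments `((1 - v)⁺ ^ p - 1) * v ^ (-1 - 2 * p)`. -/
noncomputable def backwardKernel (p v : ℝ) : ℝ :=
  ((max (1 - v) 0) ^ p - 1) * v ^ (-1 - 2 * p)

lemma continuousOn_backwardKernel {p : ℝ} (hp : 0 < p) :
    ContinuousOn (backwardKernel p) (Ioi 0) := by
  refine ContinuousOn.mul ?_ ?_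
  · exact ((((continuous_const.sub continuous_id).max continuous_const).rpow_const
      (fun _ => Or.inr hp.le)).sub continuous_const).continuousOn
  · exact continuousOn_id.rpow_const fun v hv => Or.inl (ne_of_gt hv)

lemma intervalIntegrable_backwardKernel {p a b : ℝ} (hp : 0 < p) (ha : 0 < a) (hb : 0 < b) :
    IntervalIntegrable (backwardKernel p) volume a b :=
  ((continuousOn_backwardKernel hp).mono fun _ hx => (lt_min ha hb).trans_le hx.1).intervalIntegrable

lemma hasDerivAt_integral_backwardKernel {p b : ℝ} (hp : 0 < p) (hb : 0 < b) :
    HasDerivAt (fun u => ∫ v in (1 : ℝ)..u, backwardKernel p v) (backwardKernel p b) b :=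
  intervalIntegral.integral_hasDerivAt_right (intervalIntegrable_backwardKernel hp one_pos hb)
    ((continuousOn_backwardKernel hp).stronglyMeasurableAtFilter isOpen_Ioi b hb)
    ((continuousOn_backwardKernel hp).continuousAt (Ioi_mem_nhds hb))

lemma abs_backwardKernel_le {p v : ℝ} (hp : 0 < p) (hp1 : p < 1) (hv : 0 < v) (hv1 : v ≤ 1) :
    |backwardKernel p v| ≤ v ^ (-2 * p) := by
  have h1 : max (1 - v) 0 = 1 - v := max_eq_left (by linarith)
  have h2 : 1 - v ≤ (1 - v) ^ p :=
    Real.self_le_rpow_of_le_one (by linarith) (by linarith) hp1.le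
  have h3 : (1 - v) ^ p ≤ 1 := Real.rpow_le_one (by linarith) (by linarith) hp.le
  have h4 : v ^ (-2 * p) = v * v ^ (-1 - 2 * p) := by
    rw [← Real.rpow_one_add' hv.le (by linarith)]
    ring_nf
  rw [backwardKernel, h1, abs_mul, abs_of_nonneg (Real.rpow_nonneg hv.le (-1 - 2 * p)), h4]
  gcongr
  rw [abs_le]
  constructor <;> linarith

lemma integral_backwardKernel_of_one_le {p s : ℝ} (hp : 0 < p) (hs : 1 ≤ s) :
    ∫ v in (1 : ℝ)..s, backwardKernel p v = (s ^ (-2 * p) - 1) / (2 * p) := by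
  have h : ∀ v ∈ uIcc 1 s, backwardKernel p v = -v ^ (-1 - 2 * p) := fun v hv => by
    rw [uIcc_of_le hs] at hv
    rw [backwardKernel, max_eq_right (by linarith [hv.1]), Real.zero_rpow hp.ne']
    ring
  rw [intervalIntegral.integral_congr h, intervalIntegral.integral_neg, integral_rpow]
  · rw [show -1 - 2 * p + 1 = -2 * p by ring, Real.one_rpow]
    field_simp
  · refine Or.inr ⟨by linarith, fun h0 => ?_⟩
    rw [uIcc_of_le hs] at h0
    linarith [h0.1]

/-- A primitive of `posPowSecondDiff p s * s ^ (-1 - 2 * p)` that vanishes at `0` and at `∞`. -/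
noncomputable def secondDiffPrimitive (p s : ℝ) : ℝ :=
  ((1 + s) ^ p - 1) ^ 2 * s ^ (-2 * p) / (2 * p) +
    ∫ v in (s / (1 + s))..s, backwardKernel p v

lemma secondDiffPrimitive_eq {p s : ℝ} (hp : 0 < p) (hs : 0 < s) :
    secondDiffPrimitive p s = ((1 + s) ^ p - 1) ^ 2 * s ^ (-2 * p) / (2 * p) +
      ((∫ v in (1 : ℝ)..s, backwardKernel p v) -
        ∫ v in (1 : ℝ)..(s / (1 + s)), backwardKernel p v) := by
  rw [secondDiffPrimitive, intervalIntegral.integral_interval_sub_left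
    (intervalIntegrable_backwardKernel hp one_pos hs)
    (intervalIntegrable_backwardKernel hp one_pos (by positivity))]

lemma hasDerivAt_secondDiffPrimitive {p s : ℝ} (hp : 0 < p) (hs : 0 < s) :
    HasDerivAt (secondDiffPrimitive p) (posPowSecondDiff p s * s ^ (-1 - 2 * p)) s := by
  have h1s : 0 < 1 + s := by linarith
  have hq : HasDerivAt (fun s : ℝ => s / (1 + s)) (((1 + s) ^ 2)⁻¹) s := by
    convert! (hasDerivAt_id s).div ((hasDerivAt_id s).const_add 1) h1s.ne' using 1
    simp only [id]
    field_simp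
    ring
  have hpow : HasDerivAt (fun s : ℝ => (1 + s) ^ p - 1) (p * (1 + s) ^ (p - 1)) s := by
    convert! (((hasDerivAt_id s).const_add 1).rpow_const (p := p)
      (Or.inl h1s.ne')).sub_const 1 using 1
    simp
  have hneg : HasDerivAt (fun s : ℝ => s ^ (-2 * p)) (-2 * p * s ^ (-2 * p - 1)) s :=
    Real.hasDerivAt_rpow_const (Or.inl hs.ne')
  have hd := (((hpow.pow 2).mul hneg).div_const (2 * p)).add
    ((hasDerivAt_integral_backwardKernel hp hs).sub
      ((hasDerivAt_integral_backwardKernel hp (div_pos hs h1s)).comp s hq))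
  refine (hd.congr_of_eventuallyEq ?_).congr_deriv ?_
  · filter_upwards [Ioi_mem_nhds hs] with t ht
    exact secondDiffPrimitive_eq hp ht
  · have e1 : max (1 - s / (1 + s)) 0 = (1 + s)⁻¹ := by
      rw [max_eq_left]
      · field_simp
        ring
      · rw [sub_nonneg, div_le_one h1s]
        linarith
    have e2 : max (1 + s) 0 = 1 + s := max_eq_left h1s.le
    have e3 : (s / (1 + s)) ^ (-1 - 2 * p) =
        s ^ (-1 - 2 * p) * ((1 + s) * ((1 + s) ^ p) ^ 2) := by
      rw [Real.div_rpow hs.le h1s.le, div_eq_mul_inv, ← Real.rpow_neg h1s.le,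
        ← Real.rpow_natCast, ← Real.rpow_mul h1s.le, ← Real.rpow_one_add' h1s.le]
      · push_cast
        ring_nf
      · push_cast
        linarith
    have e4 : s ^ (-2 * p) = s * s ^ (-1 - 2 * p) := by
      rw [← Real.rpow_one_add' hs.le (by linarith)]
      ring_nf
    have e5 : s ^ (-2 * p - 1) = s ^ (-1 - 2 * p) := by ring_nf
    have e6 : (1 + s) ^ (p - 1) = (1 + s) ^ p / (1 + s) := Real.rpow_sub_one h1s.ne' p
    have hx : (1 + s) ^ p ≠ 0 := (Real.rpow_pos_of_pos h1s p).ne'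
    simp only [backwardKernel, posPowSecondDiff, Pi.pow_apply]
    rw [e1, e2, e3, e4, e5, e6, Real.inv_rpow h1s.le]
    field_simp
    push_cast
    ring

lemma tendsto_secondDiffPrimitive_zero {p : ℝ} (hp : 0 < p) (hp1 : p < 1) :
    Tendsto (secondDiffPrimitive p) (𝓝[>] 0) (𝓝 0) := by
  have hlim : Tendsto (fun s : ℝ => (1 / (2 * p) + (2 : ℝ)⁻¹ ^ (-2 * p)) * s ^ (2 - 2 * p))
      (𝓝[>] 0) (𝓝 0) := by
    have : Tendsto (fun s : ℝ => s ^ (2 - 2 * p)) (𝓝 0) (𝓝 0) := by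
      have h := (Real.continuousAt_rpow_const 0 (2 - 2 * p) (Or.inr (by linarith))).tendsto
      rwa [Real.zero_rpow (by linarith)] at h
    simpa using (this.mono_left nhdsWithin_le_nhds).const_mul
      (1 / (2 * p) + (2 : ℝ)⁻¹ ^ (-2 * p))
  refine squeeze_zero_norm' ?_ hlim
  filter_upwards [Ioo_mem_nhdsGT one_pos] with s hs
  obtain ⟨hs0, hs1⟩ := hs
  have h1s : 0 < 1 + s := by linarith
  have hsq : s ^ (2 - 2 * p) = s ^ 2 * s ^ (-2 * p) := by
    rw [← Real.rpow_natCast, ← Real.rpow_add hs0]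
    push_cast
    ring_nf
  have hle : s / (1 + s) ≤ s := div_le_self hs0.le (by linarith)
  have hhalf : 2⁻¹ * s ≤ s / (1 + s) := by
    rw [le_div_iff₀ h1s]
    nlinarith
  have hfint : ‖∫ v in (s / (1 + s))..s, backwardKernel p v‖ ≤
      (2⁻¹ * s) ^ (-2 * p) * |s - s / (1 + s)| := by
    refine intervalIntegral.norm_integral_le_of_norm_le_const fun v hv => ?_
    rw [uIoc_of_le hle] at hv
    have hv0 : 2⁻¹ * s ≤ v := hhalf.trans hv.1.le
    refine (abs_backwardKernel_le hp hp1 (by linarith) (by linarith [hv.2])).trans ?_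
    exact Real.rpow_le_rpow_of_nonpos (by positivity) hv0 (by linarith)
  have hdiff : |s - s / (1 + s)| ≤ s ^ 2 := by
    rw [abs_of_nonneg (by linarith), sub_le_iff_le_add, ← sub_le_iff_le_add', le_div_iff₀ h1s]
    nlinarith [pow_pos hs0 3]
  have hup : (1 + s) ^ p ≤ 1 + s := Real.rpow_le_self_of_one_le (by linarith) hp1.le
  have hlow : 1 ≤ (1 + s) ^ p := Real.one_le_rpow (by linarith) hp.le
  have hpos : 0 < s ^ (-2 * p) := Real.rpow_pos_of_pos hs0 _
  refine (norm_add_le _ _).trans ?_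
  rw [add_mul]
  refine add_le_add ?_ (hfint.trans ?_)
  · rw [Real.norm_of_nonneg (by positivity), hsq, div_mul_eq_mul_div, one_mul]
    gcongr
    linarith
  · rw [Real.mul_rpow (by norm_num) hs0.le, hsq, mul_assoc, mul_comm (s ^ 2)]
    gcongr

lemma tendsto_secondDiffPrimitive_atTop {p : ℝ} (hp : 0 < p) :
    Tendsto (secondDiffPrimitive p) atTop (𝓝 0) := by
  have hinv : Tendsto (fun s : ℝ => s⁻¹) atTop (𝓝 0) := tendsto_inv_atTop_zero
  have hfrac : Tendsto (fun s : ℝ => s / (1 + s)) atTop (𝓝 1) := by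
    have h : Tendsto (fun s : ℝ => (s⁻¹ + 1)⁻¹) atTop (𝓝 1) := by
      simpa using (hinv.add_const 1).inv₀ (by norm_num)
    refine h.congr' ?_
    filter_upwards [eventually_gt_atTop 0] with s hs
    field_simp
  have hint1 : Tendsto (fun s : ℝ => ∫ v in (1 : ℝ)..(s / (1 + s)), backwardKernel p v) atTop
      (𝓝 0) := by
    have h := (hasDerivAt_integral_backwardKernel hp one_pos).continuousAt.tendsto.comp hfrac
    simpa [Function.comp_def] using h
  have hneg : Tendsto (fun s : ℝ => s ^ (-2 * p)) atTop (𝓝 0) := by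
    simpa using tendsto_rpow_neg_atTop (y := 2 * p) (by linarith)
  have hneg' : Tendsto (fun s : ℝ => s ^ (-p)) atTop (𝓝 0) := tendsto_rpow_neg_atTop hp
  have hint2 : Tendsto (fun s : ℝ => ∫ v in (1 : ℝ)..s, backwardKernel p v) atTop
      (𝓝 ((0 - 1) / (2 * p))) := by
    refine ((hneg.sub_const 1).div_const (2 * p)).congr' ?_
    filter_upwards [eventually_ge_atTop 1] with s hs
    exact (integral_backwardKernel_of_one_le hp hs).symm
  have hQ : Tendsto (fun s : ℝ => ((1 + s) ^ p - 1) ^ 2 * s ^ (-2 * p) / (2 * p)) atTop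
      (𝓝 ((1 - 0) ^ 2 / (2 * p))) := by
    have hb : Tendsto (fun s : ℝ => (s⁻¹ + 1) ^ p) atTop (𝓝 1) := by
      simpa using (hinv.add_const 1).rpow_const (p := p) (Or.inr hp.le)
    refine (((hb.sub hneg').pow 2).div_const (2 * p)).congr' ?_
    filter_upwards [eventually_gt_atTop 0] with s hs
    have e1 : s⁻¹ + 1 = (1 + s) / s := by field_simp
    have e2 : s ^ (-2 * p) = (s ^ (-p)) ^ 2 := by
      rw [← Real.rpow_natCast, ← Real.rpow_mul hs.le]
      push_cast
      ring_nf
    rw [e1, e2, Real.div_rpow (by linarith) hs.le, Real.rpow_neg hs.le]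
    field_simp
  have h := hQ.add (hint2.sub hint1)
  have h0 : (1 - 0) ^ 2 / (2 * p) + ((0 - 1) / (2 * p) - 0) = 0 := by ring
  rw [h0] at h
  refine h.congr' ?_
  filter_upwards [eventually_gt_atTop 0] with s hs
  exact (secondDiffPrimitive_eq hp hs).symm

lemma integral_posPowSecondDiff_mul_rpow {p : ℝ} (hp : 0 < p) (hp1 : p < 1) :
    ∫ s in Ioi (0 : ℝ), posPowSecondDiff p s * s ^ (-1 - 2 * p) = 0 := by
  have h0 : secondDiffPrimitive p 0 = 0 := by simp [secondDiffPrimitive]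
  have hcont : ContinuousWithinAt (secondDiffPrimitive p) (Ici 0) 0 := by
    rw [← continuousWithinAt_Ioi_iff_Ici, ContinuousWithinAt, h0]
    exact tendsto_secondDiffPrimitive_zero hp hp1
  rw [integral_Ioi_of_hasDerivAt_of_tendsto hcont
    (fun s hs => hasDerivAt_secondDiffPrimitive hp hs) (integrableOn_posPowSecondDiff hp hp1)
    (tendsto_secondDiffPrimitive_atTop hp), h0, sub_zero]

lemma integral_posPowSecondDiff_comp_mul {p : ℝ} (hp : 0 < p) (hp1 : p < 1) (k : ℝ) :
    ∫ r in Ioi (0 : ℝ), posPowSecondDiff p (k * r) * r ^ (-1 - 2 * p) = 0 := by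
  rcases eq_or_ne k 0 with rfl | hk
  · simp [posPowSecondDiff]
    norm_num
  have hk' : 0 < |k| := abs_pos.2 hk
  have h := integral_comp_mul_left_Ioi
    (fun s => posPowSecondDiff p s * s ^ (-1 - 2 * p)) 0 hk'
  rw [mul_zero, integral_posPowSecondDiff_mul_rpow hp hp1, smul_zero] at h
  have hcongr : ∫ r in Ioi (0 : ℝ), posPowSecondDiff p (k * r) * r ^ (-1 - 2 * p) =
      ∫ r in Ioi (0 : ℝ), (|k| ^ (-1 - 2 * p))⁻¹ *
        (posPowSecondDiff p (|k| * r) * (|k| * r) ^ (-1 - 2 * p)) := by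
    refine setIntegral_congr_fun measurableSet_Ioi fun r hr => ?_
    have hr0 : 0 < r := hr
    have hpos := (Real.rpow_pos_of_pos hk' (-1 - 2 * p)).ne'
    have he : posPowSecondDiff p (|k| * r) = posPowSecondDiff p (k * r) := by
      rw [← posPowSecondDiff_abs p (k * r), abs_mul, abs_of_pos hr0]
    simp only [he]
    rw [Real.mul_rpow hk'.le hr0.le]
    field_simp
  rw [hcongr, integral_const_mul, h, mul_zero]

lemma pow_pred_mul_rpow_neg_sub {n : ℕ} (hn : 0 < n) {r p : ℝ} (hr : 0 < r) :
    r ^ (n - 1) * r ^ (-(n : ℝ) - 2 * p) = r ^ (-1 - 2 * p) := by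
  rw [← Real.rpow_natCast, ← Real.rpow_add hr, Nat.cast_pred hn]
  ring_nf

/-- A symmetric set integral is controlled by the integral of the symmetrized function; no
integrability is needed since otherwise the left-hand side vanishes. -/
lemma norm_setIntegral_le_norm_setIntegral_add_comp_neg {E : Type*} [NormedAddCommGroup E]
    [MeasurableSpace E] [BorelSpace E] (μ : Measure E) [μ.IsNegInvariant] {f : E → ℝ} {s : Set E}
    (hs : MeasurableSet s) (hneg : -s = s) :
    ‖∫ z in s, f z ∂μ‖ ≤ ‖∫ z in s, (f z + f (-z)) ∂μ‖ := by
  by_cases hf : IntegrableOn f s μ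
  · have hmp : MeasurePreserving (fun z : E => -z) (μ.restrict s) (μ.restrict s) := by
      have := (Measure.measurePreserving_neg μ).restrict_preimage hs
      rwa [show (Neg.neg : E → E) ⁻¹' s = s from hneg] at this
    have hemb : MeasurableEmbedding (fun z : E => -z) := (MeasurableEquiv.neg E).measurableEmbedding
    have hfneg : IntegrableOn (fun z => f (-z)) s μ := (hmp.integrable_comp_emb hemb).2 hf
    have heq : ∫ z in s, f (-z) ∂μ = ∫ z in s, f z ∂μ := hmp.integral_comp hemb f
    rw [integral_add hf hfneg, heq, ← two_mul, norm_mul, Real.norm_two]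
    linarith [norm_nonneg (∫ z in s, f z ∂μ)]
  · rw [integral_undef hf, norm_zero]
    exact norm_nonneg _

section Polar

variable {E : Type*} [NormedAddCommGroup E] [NormedSpace ℝ E] [Nontrivial E]
  [FiniteDimensional ℝ E] [MeasurableSpace E] [BorelSpace E] (μ : Measure E) [μ.IsAddHaarMeasure]

lemma integral_eq_zero_of_integral_radial_eq_zero {f : E → ℝ} (hf : Integrable f μ)
    (h : ∀ θ : E, ∫ r in Ioi (0 : ℝ), r ^ (Module.finrank ℝ E - 1) * f (r • θ) = 0) :
    ∫ z, f z ∂μ = 0 := by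
  have hmp := (μ.measurePreserving_homeomorphUnitSphereProd).symm
    (homeomorphUnitSphereProd E).toMeasurableEquiv
  have hemb := (homeomorphUnitSphereProd E).symm.measurableEmbedding
  have hfint : Integrable (fun q : Metric.sphere (0 : E) 1 × Ioi (0 : ℝ) => f (q.2.1 • q.1.1))
      (μ.toSphere.prod (.volumeIoiPow (Module.finrank ℝ E - 1))) := by
    have h1 : Integrable (fun z : ({0}ᶜ : Set E) => f z) (μ.comap (↑)) :=
      (integrableOn_iff_comap_subtypeVal (measurableSet_singleton _).compl).1 hf.integrableOn
    exact (hmp.integrable_comp_emb hemb).2 h1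
  calc ∫ z, f z ∂μ = ∫ z : ({0}ᶜ : Set E), f z ∂(μ.comap (↑)) := by
        rw [integral_subtype_comap (measurableSet_singleton _).compl f, restrict_compl_singleton]
    _ = ∫ q : Metric.sphere (0 : E) 1 × Ioi (0 : ℝ), f (q.2.1 • q.1.1)
          ∂μ.toSphere.prod (.volumeIoiPow (Module.finrank ℝ E - 1)) :=
        (hmp.integral_comp hemb fun z => f z).symm
    _ = ∫ θ : Metric.sphere (0 : E) 1, ∫ r : Ioi (0 : ℝ), f (r.1 • θ.1)
          ∂(.volumeIoiPow (Module.finrank ℝ E - 1)) ∂μ.toSphere := integral_prod _ hfint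
    _ = 0 := by
        refine integral_eq_zero_of_ae (.of_forall fun θ => ?_)
        simp only [Measure.volumeIoiPow, ENNReal.ofReal]
        rw [integral_withDensity_eq_integral_smul
          (measurable_subtype_coe.pow_const _).real_toNNReal,
          integral_subtype_comap measurableSet_Ioi fun r : ℝ =>
            Real.toNNReal (r ^ (Module.finrank ℝ E - 1)) • f (r • θ.1)]
        refine (setIntegral_congr_fun measurableSet_Ioi fun r hr => ?_).trans (h θ.1)
        simp only [NNReal.smul_def, smul_eq_mul]
        rw [Real.coe_toNNReal _ (pow_nonneg (le_of_lt (mem_Ioi.1 hr)) _)]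

lemma integrable_posPowSecondDiff_mul_norm_rpow {p : ℝ} (hp : 0 < p) (hp1 : p < 1)
    (L : E →L[ℝ] ℝ) :
    Integrable (fun z : E =>
      posPowSecondDiff p (L z) * ‖z‖ ^ (-(Module.finrank ℝ E : ℝ) - 2 * p)) μ := by
  have hL : 0 < ‖L‖ + 1 := by positivity
  set a : ℝ := (‖L‖ + 1)⁻¹ with ha_def
  have ha : 0 < a := inv_pos.2 hL
  have hdom : Integrable (fun z : E => 2 * (min ((‖z‖ / a) ^ (2 : ℝ)) ((‖z‖ / a) ^ p) *
      ‖z‖ ^ (-(Module.finrank ℝ E : ℝ) - 2 * p))) μ := by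
    refine Integrable.const_mul ?_ 2
    refine (integrable_fun_norm_addHaar μ (f := fun r : ℝ =>
      min ((r / a) ^ (2 : ℝ)) ((r / a) ^ p) * r ^ (-(Module.finrank ℝ E : ℝ) - 2 * p))).2 ?_
    refine (integrableOn_min_rpow_mul_rpow hp hp1 ha).congr_fun (fun r hr => ?_) measurableSet_Ioi
    simp only [smul_eq_mul]
    rw [mul_left_comm, pow_pred_mul_rpow_neg_sub Module.finrank_pos hr]
  refine hdom.mono' ?_ (.of_forall fun z => ?_)
  · exact (((continuous_posPowSecondDiff hp).comp L.continuous).measurable.mul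
      (measurable_norm.pow_const _)).aestronglyMeasurable
  · rw [norm_mul, Real.norm_of_nonneg (Real.rpow_nonneg (norm_nonneg z) _), ← mul_assoc]
    gcongr
    refine abs_posPowSecondDiff_le_min hp hp1 ?_
    rw [ha_def, div_inv_eq_mul, mul_comm]
    refine (L.le_opNorm z).trans ?_
    gcongr
    linarith

lemma integral_posPowSecondDiff_mul_norm_rpow {p : ℝ} (hp : 0 < p) (hp1 : p < 1)
    (L : E →L[ℝ] ℝ) :
    ∫ z : E, posPowSecondDiff p (L z) * ‖z‖ ^ (-(Module.finrank ℝ E : ℝ) - 2 * p) ∂μ = 0 := by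
  refine integral_eq_zero_of_integral_radial_eq_zero μ
    (integrable_posPowSecondDiff_mul_norm_rpow μ hp hp1 L) fun θ => ?_
  have hcongr : ∫ r in Ioi (0 : ℝ), r ^ (Module.finrank ℝ E - 1) *
        (posPowSecondDiff p (L (r • θ)) * ‖r • θ‖ ^ (-(Module.finrank ℝ E : ℝ) - 2 * p)) =
      ∫ r in Ioi (0 : ℝ), ‖θ‖ ^ (-(Module.finrank ℝ E : ℝ) - 2 * p) *
        (posPowSecondDiff p (L θ * r) * r ^ (-1 - 2 * p)) := by
    refine setIntegral_congr_fun measurableSet_Ioi fun r hr => ?_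
    have hr0 : 0 < r := hr
    simp only [map_smul, smul_eq_mul, norm_smul, Real.norm_of_nonneg hr0.le]
    rw [Real.mul_rpow hr0.le (norm_nonneg θ),
      ← pow_pred_mul_rpow_neg_sub (Module.finrank_pos (R := ℝ) (M := E)) hr0,
      mul_comm r]
    ring
  rw [hcongr, integral_const_mul, integral_posPowSecondDiff_comp_mul hp hp1, mul_zero]

lemma aecover_lt_norm : AECover μ (𝓝[>] (0 : ℝ)) (fun ε => {z : E | ε < ‖z‖}) where
  ae_eventually_mem := by
    filter_upwards [Measure.ae_ne μ 0] with z hz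
    filter_upwards [Ioo_mem_nhdsGT (norm_pos_iff.2 hz)] with ε hε
    exact hε.2
  measurableSet ε := measurableSet_lt measurable_const measurable_norm

end Polar

lemma max_add_rpow_add_max_sub_rpow {p a t : ℝ} (ha : 0 < a) :
    (max (a + t) 0) ^ p - (max a 0) ^ p + ((max (a - t) 0) ^ p - (max a 0) ^ p) =
      a ^ p * posPowSecondDiff p (a⁻¹ * t) := by
  have e1 : max (a + t) 0 = a * max (1 + a⁻¹ * t) 0 := by
    rw [mul_max_of_nonneg _ _ ha.le, mul_zero, mul_add, mul_one, mul_inv_cancel_left₀ ha.ne']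
  have e2 : max (a - t) 0 = a * max (1 - a⁻¹ * t) 0 := by
    rw [mul_max_of_nonneg _ _ ha.le, mul_zero, mul_sub, mul_one, mul_inv_cancel_left₀ ha.ne']
  rw [e1, e2, max_eq_left ha.le, Real.mul_rpow ha.le (le_max_right _ _),
    Real.mul_rpow ha.le (le_max_right _ _), posPowSecondDiff]
  ring

lemma pvInt_eq_setIntegral_norm (d : ℕ) (α : ℝ) (u : EuclideanSpace ℝ (Fin d) → ℝ)
    (x : EuclideanSpace ℝ (Fin d)) (ε : ℝ) :
    pvInt d α u x ε = ∫ z in {z : EuclideanSpace ℝ (Fin d) | ε < ‖z‖},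
      (u (x + z) - u x) / ‖z‖ ^ ((d : ℝ) + α) := by
  have hmp := (measurePreserving_add_left (volume : Measure (EuclideanSpace ℝ (Fin d))) x)
  have h := hmp.setIntegral_preimage_emb (measurableEmbedding_addLeft x)
    (fun y => (u y - u x) / dist x y ^ ((d : ℝ) + α)) {y | ε < dist y x}
  rw [pvInt, ← h]
  simp [Set.preimage]

/-- For `w_{α/2}(x) = (x₁⁺)^{α/2}` and any `x` with `x₁ > 0`, the principal value limit
defining `Δ^{α/2} w_{α/2}(x)` exists and equals `0`. -/
theorem statement0 (d : ℕ) (hd : 1 ≤ d) (α : ℝ) (hα : α ∈ Set.Ioo (0 : ℝ) 2)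
    (x : EuclideanSpace ℝ (Fin d)) (hx : 0 < x ⟨0, hd⟩) :
    Filter.Tendsto
      (pvInt d α (fun y => (max (y ⟨0, hd⟩) 0) ^ (α / 2)) x)
      (nhdsWithin 0 (Set.Ioi 0)) (nhds 0) := by
  have hp : 0 < α / 2 := by linarith [hα.1]
  have hp1 : α / 2 < 1 := by linarith [hα.2]
  have : Nonempty (Fin d) := ⟨⟨0, hd⟩⟩
  set a := x ⟨0, hd⟩
  set L : EuclideanSpace ℝ (Fin d) →L[ℝ] ℝ := a⁻¹ • EuclideanSpace.proj ⟨0, hd⟩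
  have hfint := integrable_posPowSecondDiff_mul_norm_rpow volume hp hp1 L
  have hlim := (aecover_lt_norm
    (volume : Measure (EuclideanSpace ℝ (Fin d)))).integral_tendsto_of_countably_generated hfint
  rw [integral_posPowSecondDiff_mul_norm_rpow volume hp hp1 L] at hlim
  have hlim' := (hlim.const_mul (a ^ (α / 2))).norm
  rw [mul_zero, norm_zero] at hlim'
  refine squeeze_zero_norm (fun ε => ?_) hlim'
  rw [pvInt_eq_setIntegral_norm]
  refine (norm_setIntegral_le_norm_setIntegral_add_comp_neg volume
    (measurableSet_lt measurable_const measurable_norm) (by ext z; simp)).trans_eq ?_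
  rw [← integral_const_mul]
  congr 2 with z
  rw [norm_neg, ← add_div, div_eq_mul_inv, ← Real.rpow_neg (norm_nonneg z), ← mul_assoc,
    finrank_euclideanSpace_fin]
  congr 1
  · exact max_add_rpow_add_max_sub_rpow hx
  · ring_nf
end

section
/- For every integer d ≥ 1, every α ∈ (0,2) and every p ∈ (α/2, α), there exist constants R_* ∈ (0,1) and C ≥ c > 0, depending only on p, d and α, such that for every x ∈ ℝ^d with 0 < x_1 ≤ R_*, the limit defining the truncated fractional Laplacian Δ̂^{α/2} w_p(x) exists and c · x_1^{p−α} ≤ Δ̂^{α/2} w_p(x) ≤ C · x_1^{p−α}. -/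
open MeasureTheory Filter Set

/-- The truncated integral ∫_{ε<|y-x|≤1} (u(y)-u(x)) |x-y|^{-d-α} dy whose limit
as ε ↓ 0 defines the truncated fractional Laplacian Δ̂^{α/2}u(x)
(up to the constant `fracConst`). -/
noncomputable def pvIntTr (d : ℕ) (α : ℝ) (u : EuclideanSpace ℝ (Fin d) → ℝ)
    (x : EuclideanSpace ℝ (Fin d)) (ε : ℝ) : ℝ :=
  ∫ y in {y : EuclideanSpace ℝ (Fin d) | ε < dist y x ∧ dist y x ≤ 1},
    (u y - u x) / dist x y ^ ((d : ℝ) + α)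

/-- The symmetric second difference at `1` of the function `s ↦ (s⁺)^p`. -/
noncomputable def posPartPowDiff (p t : ℝ) : ℝ :=
  (max (1 + t) 0) ^ p + (max (1 - t) 0) ^ p - 2

lemma posPartPowDiff_neg (p t : ℝ) : posPartPowDiff p (-t) = posPartPowDiff p t := by
  simp only [posPartPowDiff, sub_neg_eq_add, ← sub_eq_add_neg]
  ring

lemma posPartPowDiff_abs (p t : ℝ) : posPartPowDiff p |t| = posPartPowDiff p t := by
  rcases abs_choice t with h | h <;> rw [h]
  exact posPartPowDiff_neg p t

@[fun_prop]
lemma measurable_posPartPowDiff (p : ℝ) : Measurable (posPartPowDiff p) := by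
  unfold posPartPowDiff
  fun_prop

lemma abs_posPartPowDiff_le_sq {p t : ℝ} (hp : 0 < p) (hp2 : p < 2) (ht : |t| ≤ 1) :
    |posPartPowDiff p t| ≤ 2 * t ^ 2 := by
  obtain ⟨h1, h2⟩ := abs_le.1 ht
  have ha : 0 ≤ 1 + t := by linarith
  have hb : 0 ≤ 1 - t := by linarith
  have hsq : t ^ 2 ≤ 1 := (sq_le_one_iff_abs_le_one t).2 ht
  have hpow (s : ℝ) (hs : 0 ≤ s) : s ^ p = (s ^ 2) ^ (p / 2) := by
    rw [← Real.rpow_natCast, ← Real.rpow_mul hs]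
    congr 1
    push_cast
    ring
  have hupper : (1 + t) ^ p + (1 - t) ^ p ≤ 2 * (1 + t ^ 2) := by
    have hconc := (Real.concaveOn_rpow (p := p / 2) (by positivity) (by linarith)).2
      (mem_Ici.2 (sq_nonneg (1 + t))) (mem_Ici.2 (sq_nonneg (1 - t)))
      (by norm_num : (0 : ℝ) ≤ 1 / 2) (by norm_num : (0 : ℝ) ≤ 1 / 2) (by norm_num)
    simp only [smul_eq_mul] at hconc
    rw [hpow _ ha, hpow _ hb]
    have heq : 1 / 2 * (1 + t) ^ 2 + 1 / 2 * (1 - t) ^ 2 = 1 + t ^ 2 := by ring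
    rw [heq] at hconc
    have hle := Real.rpow_le_rpow_of_exponent_le (x := 1 + t ^ 2) (y := p / 2) (z := 1)
      (by nlinarith) (by linarith)
    rw [Real.rpow_one] at hle
    linarith
  have hlower : 2 * (1 - t ^ 2) ≤ (1 + t) ^ p + (1 - t) ^ p := by
    have hle := Real.rpow_le_rpow_of_exponent_ge' (x := 1 - t ^ 2) (y := 1) (z := p / 2)
      (by linarith) (by nlinarith) (by positivity) (by linarith)
    have hhalf (s : ℝ) (hs : 0 ≤ s) : s ^ p = (s ^ (p / 2)) ^ 2 := by
      rw [← Real.rpow_natCast, ← Real.rpow_mul hs]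
      congr 1
      push_cast
      ring
    have hprod : 1 - t ^ 2 = (1 + t) * (1 - t) := by ring
    rw [Real.rpow_one] at hle
    rw [hhalf _ ha, hhalf _ hb]
    have hmul := Real.mul_rpow (z := p / 2) ha hb
    rw [← hprod] at hmul
    nlinarith [sq_nonneg ((1 + t) ^ (p / 2) - (1 - t) ^ (p / 2))]
  rw [posPartPowDiff, max_eq_left ha, max_eq_left hb, abs_le]
  constructor <;> linarith

lemma abs_posPartPowDiff_le_rpow {p t : ℝ} (hp : 0 < p) (hp2 : p < 2) (ht : 1 ≤ |t|) :
    |posPartPowDiff p t| ≤ 6 * |t| ^ p := by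
  rw [← posPartPowDiff_abs, posPartPowDiff, max_eq_left (by positivity : 0 ≤ 1 + |t|),
    max_eq_right (by linarith : 1 - |t| ≤ 0), Real.zero_rpow hp.ne']
  have h1 : (1 + |t|) ^ p ≤ (2 * |t|) ^ p :=
    Real.rpow_le_rpow (by positivity) (by linarith) hp.le
  rw [Real.mul_rpow (by norm_num) (abs_nonneg t)] at h1
  have h2 : (2 : ℝ) ^ p ≤ 2 ^ (2 : ℝ) :=
    Real.rpow_le_rpow_of_exponent_le (by norm_num) hp2.le
  norm_num at h2
  have h3 : 1 ≤ |t| ^ p := Real.one_le_rpow ht hp.le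
  have h4 : 0 ≤ (1 + |t|) ^ p := by positivity
  rw [abs_le]
  constructor <;> nlinarith

/-- A radial majorant for `posPartPowDiff p`. -/
noncomputable def sqRpowMajorant (p r : ℝ) : ℝ := if r ≤ 1 then r ^ 2 else r ^ p

@[fun_prop]
lemma measurable_sqRpowMajorant (p : ℝ) : Measurable (sqRpowMajorant p) :=
  Measurable.ite measurableSet_Iic (by fun_prop) (by fun_prop)

lemma abs_posPartPowDiff_le_majorant {p t r : ℝ} (hp : 0 < p) (hp2 : p < 2) (htr : |t| ≤ r) :
    |posPartPowDiff p t| ≤ 6 * sqRpowMajorant p r := by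
  have hsq : t ^ 2 ≤ r ^ 2 := sq_le_sq' (neg_le_of_abs_le htr) (le_of_abs_le htr)
  unfold sqRpowMajorant
  split_ifs with hr
  · nlinarith [abs_posPartPowDiff_le_sq hp hp2 (htr.trans hr), sq_nonneg t]
  · rcases le_total |t| 1 with ht | ht
    · have := abs_posPartPowDiff_le_sq hp hp2 ht
      have h1 : 1 ≤ r ^ p := Real.one_le_rpow (not_le.1 hr).le hp.le
      have h2 : t ^ 2 ≤ 1 := (sq_le_one_iff_abs_le_one t).2 ht
      linarith
    · have := abs_posPartPowDiff_le_rpow hp hp2 ht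
      have := Real.rpow_le_rpow (abs_nonneg t) htr hp.le
      linarith

lemma integrableOn_sqRpowMajorant {p α : ℝ} (hα : α < 2) (hpα : p < α) :
    IntegrableOn (fun r => sqRpowMajorant p r * r ^ (-1 - α)) (Ioi 0) := by
  rw [← Ioc_union_Ioi_eq_Ioi (zero_le_one' ℝ), integrableOn_union]
  constructor
  · have h : IntegrableOn (fun r : ℝ => r ^ (1 - α)) (Ioc 0 1) := by
      rw [← intervalIntegrable_iff_integrableOn_Ioc_of_le zero_le_one]
      exact intervalIntegral.intervalIntegrable_rpow' (by linarith)
    refine h.congr_fun (fun r hr => ?_) measurableSet_Ioc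
    simp only [sqRpowMajorant, if_pos hr.2]
    rw [← Real.rpow_natCast, ← Real.rpow_add hr.1]
    congr 1
    push_cast
    ring
  · have h : IntegrableOn (fun r : ℝ => r ^ (p - 1 - α)) (Ioi 1) :=
      integrableOn_Ioi_rpow_of_lt (by linarith) one_pos
    refine h.congr_fun (fun r hr => ?_) measurableSet_Ioi
    have hr1 : 1 < r := hr
    simp only [sqRpowMajorant, if_neg hr1.not_ge]
    rw [← Real.rpow_add (by linarith)]
    congr 1
    ring

lemma integrableOn_posPartPowDiff_mul_rpow {p α : ℝ} (hp : 0 < p) (hα : α < 2) (hpα : p < α) :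
    IntegrableOn (fun t => posPartPowDiff p t * t ^ (-1 - α)) (Ioi 0) := by
  refine ((integrableOn_sqRpowMajorant hα hpα).const_mul 6).mono'
    (by fun_prop) ?_
  filter_upwards [ae_restrict_mem measurableSet_Ioi] with t ht
  have ht0 : 0 < t := ht
  rw [norm_mul, Real.norm_eq_abs, Real.norm_of_nonneg (by positivity), ← mul_assoc]
  gcongr
  exact abs_posPartPowDiff_le_majorant hp (hpα.trans hα) (abs_of_pos ht0).le

lemma integrableOn_one_add_rpow_sub_one {p α ε : ℝ} (hp : 0 < p) (hpα : p < α) (hε : 0 < ε) :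
    IntegrableOn (fun t : ℝ => ((1 + t) ^ p - 1) * t ^ (-1 - α)) (Ioi ε) := by
  have h1 : IntegrableOn (fun t : ℝ => (1 / ε + 1) ^ p * t ^ (p - 1 - α)) (Ioi ε) :=
    (integrableOn_Ioi_rpow_of_lt (by linarith) hε).const_mul _
  refine h1.mono' (by fun_prop) ?_
  filter_upwards [ae_restrict_mem measurableSet_Ioi] with t ht
  have ht0 : 0 < t := hε.trans ht
  have hge : 1 ≤ (1 + t) ^ p := Real.one_le_rpow (by linarith) hp.le
  have hle : (1 + t) ^ p ≤ (1 / ε + 1) ^ p * t ^ p := by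
    rw [← Real.mul_rpow (by positivity) ht0.le]
    refine Real.rpow_le_rpow (by positivity) ?_ hp.le
    have h2 : 1 ≤ 1 / ε * t := by
      rw [one_div_mul_eq_div, le_div_iff₀ hε, one_mul]
      exact le_of_lt ht
    linarith
  rw [Real.norm_of_nonneg (mul_nonneg (by linarith) (by positivity)),
    show p - 1 - α = p + (-1 - α) by ring, Real.rpow_add ht0, ← mul_assoc]
  gcongr
  linarith

lemma image_div_one_sub_Ioo {ε : ℝ} (hε : 0 < ε) (hε1 : ε < 1) :
    (fun s : ℝ => s / (1 - s)) '' Ioo ε 1 = Ioi (ε / (1 - ε)) := by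
  ext t
  simp only [mem_image, mem_Ioo, mem_Ioi]
  constructor
  · rintro ⟨s, ⟨h1, h2⟩, rfl⟩
    rw [div_lt_div_iff₀ (by linarith) (by linarith)]
    nlinarith
  · intro ht
    have ht0 : 0 < t := lt_trans (div_pos hε (by linarith)) ht
    rw [div_lt_iff₀ (by linarith)] at ht
    refine ⟨t / (1 + t), ⟨?_, ?_⟩, ?_⟩
    · rw [lt_div_iff₀ (by linarith)]
      linarith
    · rw [div_lt_one (by linarith)]
      linarith
    · have : 1 - t / (1 + t) = 1 / (1 + t) := by
        field_simp
        ring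
      rw [this]
      field_simp

lemma injOn_div_one_sub (ε : ℝ) : InjOn (fun s : ℝ => s / (1 - s)) (Ioo ε 1) := by
  intro s hs t ht hst
  have h1 : 1 - s ≠ 0 := by linarith [hs.2]
  have h2 : 1 - t ≠ 0 := by linarith [ht.2]
  simp only at hst
  rw [div_eq_div_iff h1 h2] at hst
  linarith

lemma hasDerivAt_div_one_sub {s : ℝ} (hs : s < 1) :
    HasDerivAt (fun s : ℝ => s / (1 - s)) (((1 - s) ^ 2)⁻¹) s := by
  have h1 : 1 - s ≠ 0 := by linarith
  refine ((hasDerivAt_id s).div ((hasDerivAt_id s).const_sub 1) h1).congr_deriv ?_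
  simp

lemma div_one_sub_integrand_eq {p α s : ℝ} (hs : 0 < s) (hs1 : s < 1) :
    |((1 - s) ^ 2)⁻¹| • (((1 + s / (1 - s)) ^ p - 1) * (s / (1 - s)) ^ (-1 - α)) =
      ((1 - s) ^ (α - 1 - p) - (1 - s) ^ (α - 1)) * s ^ (-1 - α) := by
  have h1 : 0 < 1 - s := by linarith
  have h2 : 1 + s / (1 - s) = (1 - s)⁻¹ := by
    field_simp
    ring
  have h3 : ((1 - s) ^ 2)⁻¹ * (1 - s) ^ (1 + α) = (1 - s) ^ (α - 1) := by
    rw [← Real.rpow_natCast, ← Real.rpow_neg h1.le, ← Real.rpow_add h1]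
    congr 1
    push_cast
    ring
  have h4 : (1 - s) ^ (α - 1 - p) = (1 - s) ^ (α - 1) * (1 - s) ^ (-p) := by
    rw [← Real.rpow_add h1]
    congr 1
  rw [h2, abs_of_nonneg (by positivity), Real.inv_rpow h1.le, ← Real.rpow_neg h1.le,
    div_eq_mul_inv, Real.mul_rpow hs.le (by positivity), Real.inv_rpow h1.le,
    ← Real.rpow_neg h1.le, h4, ← h3, smul_eq_mul, show -(-1 - α) = 1 + α by ring]
  ring

lemma integrableOn_inverted {p α ε : ℝ} (hp : 0 < p) (hpα : p < α) (hε : 0 < ε) (hε1 : ε < 1) :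
    IntegrableOn (fun s : ℝ => ((1 - s) ^ (α - 1 - p) - (1 - s) ^ (α - 1)) * s ^ (-1 - α))
      (Ioo ε 1) := by
  have h := (integrableOn_image_iff_integrableOn_abs_deriv_smul measurableSet_Ioo
    (fun s hs => (hasDerivAt_div_one_sub hs.2).hasDerivWithinAt) (injOn_div_one_sub ε)
    (fun t : ℝ => ((1 + t) ^ p - 1) * t ^ (-1 - α))).1
    (by
      rw [image_div_one_sub_Ioo hε hε1]
      exact integrableOn_one_add_rpow_sub_one hp hpα (div_pos hε (by linarith)))
  exact h.congr_fun (fun s hs => div_one_sub_integrand_eq (hε.trans hs.1) hs.2) measurableSet_Ioo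

lemma integral_inverted_le {p α ε : ℝ} (hp : 0 < p) (hpα : p < α) (hε : 0 < ε) (hε1 : ε < 1) :
    ∫ s in Ioo ε 1, ((1 - s) ^ (α - 1 - p) - (1 - s) ^ (α - 1)) * s ^ (-1 - α) ≤
      ∫ t in Ioi ε, ((1 + t) ^ p - 1) * t ^ (-1 - α) := by
  have h := integral_image_eq_integral_abs_deriv_smul (measurableSet_Ioo (a := ε) (b := 1))
    (fun s hs => (hasDerivAt_div_one_sub hs.2).hasDerivWithinAt) (injOn_div_one_sub ε)
    (fun t : ℝ => ((1 + t) ^ p - 1) * t ^ (-1 - α))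
  rw [← setIntegral_congr_fun measurableSet_Ioo
    (fun s hs => div_one_sub_integrand_eq (hε.trans hs.1) hs.2), ← h,
    image_div_one_sub_Ioo hε hε1]
  refine setIntegral_mono_set (integrableOn_one_add_rpow_sub_one hp hpα hε) ?_
    (Ioi_subset_Ioi ?_).eventuallyLE
  · filter_upwards [ae_restrict_mem measurableSet_Ioi] with t ht
    have ht0 : 0 < t := hε.trans ht
    have := Real.one_le_rpow (by linarith : 1 ≤ 1 + t) hp.le
    exact mul_nonneg (by linarith) (by positivity)
  · rw [le_div_iff₀ (by linarith)]
    nlinarith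

lemma integrableOn_posPart_one_sub_rpow {p α ε : ℝ} (hp : 0 < p) (hα : 0 < α) (hε : 0 < ε) :
    IntegrableOn (fun t : ℝ => ((max (1 - t) 0) ^ p - 1) * t ^ (-1 - α)) (Ioi ε) := by
  refine (integrableOn_Ioi_rpow_of_lt (by linarith : -1 - α < -1) hε).mono'
    (by fun_prop) ?_
  filter_upwards [ae_restrict_mem measurableSet_Ioi] with t ht
  have ht0 : 0 < t := hε.trans ht
  have h0 : 0 ≤ (max (1 - t) 0) ^ p := by positivity
  have h1 : (max (1 - t) 0) ^ p ≤ 1 :=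
    Real.rpow_le_one (le_max_right _ _) (max_le (by linarith) zero_le_one) hp.le
  rw [norm_mul, Real.norm_of_nonneg (by positivity : 0 ≤ t ^ (-1 - α))]
  refine mul_le_of_le_one_left (by positivity) ?_
  rw [Real.norm_eq_abs, abs_le]
  constructor <;> linarith

lemma integral_posPart_one_sub_rpow {p α ε : ℝ} (hp : 0 < p) (hα : 0 < α) (hε : 0 < ε)
    (hε1 : ε < 1) :
    ∫ t in Ioi ε, ((max (1 - t) 0) ^ p - 1) * t ^ (-1 - α) =
      (∫ s in Ioo ε 1, ((1 - s) ^ p - 1) * s ^ (-1 - α)) - 1 / α := by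
  have hint := integrableOn_posPart_one_sub_rpow hp hα hε
  rw [← Ioc_union_Ioi_eq_Ioi hε1.le, setIntegral_union (Ioc_disjoint_Ioi le_rfl)
    measurableSet_Ioi (hint.mono_set Ioc_subset_Ioi_self)
    (hint.mono_set (Ioi_subset_Ioi hε1.le)), integral_Ioc_eq_integral_Ioo, sub_eq_add_neg _ (1 / α)]
  congr 1
  · refine setIntegral_congr_fun measurableSet_Ioo fun t ht => ?_
    simp only [max_eq_left (by linarith [ht.2] : (0 : ℝ) ≤ 1 - t)]
  · have h : EqOn (fun t : ℝ => ((max (1 - t) 0) ^ p - 1) * t ^ (-1 - α))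
        (fun t => -t ^ (-1 - α)) (Ioi 1) := by
      intro t ht
      simp only [max_eq_right (by linarith [mem_Ioi.1 ht] : 1 - t ≤ 0), Real.zero_rpow hp.ne']
      ring
    rw [setIntegral_congr_fun measurableSet_Ioi h, integral_neg,
      integral_Ioi_rpow_of_lt (by linarith) one_pos, Real.one_rpow]
    congr 1
    rw [show -1 - α + 1 = -α by ring, neg_div_neg_eq]

/-- The density on `(0, 1)` obtained by folding the half-line integral of `s ↦ (s⁺)^p - 1`
through the inversion `y ↦ 1 / y` with `y = 1 - s`. -/
noncomputable def foldedDensity (p α s : ℝ) : ℝ :=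
  ((1 - s) ^ (α - 1 - p) - (1 - s) ^ (α - 1)) * s ^ (-1 - α) +
    ((1 - s) ^ p - 1) * s ^ (-1 - α)

lemma integrableOn_foldedDensity {p α ε : ℝ} (hp : 0 < p) (hpα : p < α) (hε : 0 < ε)
    (hε1 : ε < 1) : IntegrableOn (foldedDensity p α) (Ioo ε 1) := by
  refine (integrableOn_inverted hp hpα hε hε1).add
    (((integrableOn_posPart_one_sub_rpow hp (hp.trans hpα) hε).mono_set
      Ioo_subset_Ioi_self).congr_fun (fun t ht => ?_) measurableSet_Ioo)
  simp only [max_eq_left (by linarith [ht.2] : (0 : ℝ) ≤ 1 - t)]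

lemma integral_foldedDensity_le {p α ε : ℝ} (hp : 0 < p) (hpα : p < α) (hε : 0 < ε)
    (hε1 : ε < 1) :
    (∫ s in Ioo ε 1, foldedDensity p α s) - 1 / α ≤
      ∫ t in Ioi ε, posPartPowDiff p t * t ^ (-1 - α) := by
  have hα := hp.trans hpα
  have hB : IntegrableOn (fun s : ℝ => ((1 - s) ^ p - 1) * s ^ (-1 - α)) (Ioo ε 1) := by
    refine ((integrableOn_posPart_one_sub_rpow hp hα hε).mono_set
      Ioo_subset_Ioi_self).congr_fun (fun t ht => ?_) measurableSet_Ioo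
    simp only [max_eq_left (by linarith [ht.2] : (0 : ℝ) ≤ 1 - t)]
  have hsplit : EqOn (fun t : ℝ => posPartPowDiff p t * t ^ (-1 - α))
      (fun t => ((1 + t) ^ p - 1) * t ^ (-1 - α) + ((max (1 - t) 0) ^ p - 1) * t ^ (-1 - α))
      (Ioi ε) := by
    intro t ht
    have ht0 : 0 < t := hε.trans ht
    simp only [posPartPowDiff, max_eq_left (by linarith : 0 ≤ 1 + t)]
    ring
  rw [setIntegral_congr_fun measurableSet_Ioi hsplit,
    integral_add (integrableOn_one_add_rpow_sub_one hp hpα hε)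
      (integrableOn_posPart_one_sub_rpow hp hα hε),
    integral_posPart_one_sub_rpow hp hα hε hε1]
  simp only [foldedDensity]
  rw [integral_add (integrableOn_inverted hp hpα hε hε1) hB]
  linarith [integral_inverted_le hp hpα hε hε1]

lemma hasDerivAt_foldedDensity_half {α s : ℝ} (hα : 0 < α) (hs : 0 < s) (hs1 : s < 1) :
    HasDerivAt (fun s : ℝ => (1 - (1 - s) ^ (α / 2)) ^ 2 * s ^ (-α) / α)
      (foldedDensity (α / 2) α s) s := by
  have h1 : 0 < 1 - s := by linarith
  have hd : HasDerivAt (fun s : ℝ => (1 - s) ^ (α / 2))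
      (-1 * (α / 2) * (1 - s) ^ (α / 2 - 1)) s :=
    ((hasDerivAt_id s).const_sub 1).rpow_const (Or.inl h1.ne')
  have hd2 := (((hd.const_sub 1).pow 2).mul
    (Real.hasDerivAt_rpow_const (p := -α) (Or.inl hs.ne'))).div_const α
  refine hd2.congr_deriv ?_
  have e1 : (1 - s) ^ (α / 2) = (1 - s) * (1 - s) ^ (α / 2 - 1) := by
    rw [← Real.rpow_one_add' h1.le (by linarith)]
    congr 1
    ring
  have e2 : (1 - s) ^ (α - 1) = (1 - s) * ((1 - s) ^ (α / 2 - 1)) ^ 2 := by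
    rw [show α - 1 = 1 + (α / 2 - 1) * 2 by ring, Real.rpow_add h1, Real.rpow_one,
      Real.rpow_mul h1.le]
    norm_cast
  have e3 : s ^ (-α) = s * s ^ (-1 - α) := by
    rw [← Real.rpow_one_add' hs.le (by linarith)]
    congr 1
    ring
  simp only [foldedDensity, Pi.pow_apply, Nat.cast_ofNat, Nat.add_one_sub_one, pow_one]
  rw [show α - 1 - α / 2 = α / 2 - 1 by ring, show -α - 1 = -1 - α by ring, e2, e3, e1]
  field_simp
  ring

lemma foldedDensity_sub_half {p α s : ℝ} (hs1 : s < 1) :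
    foldedDensity p α s - foldedDensity (α / 2) α s =
      (1 - (1 - s) ^ (p - α / 2)) * ((1 - s) ^ (α - 1 - p) - (1 - s) ^ (α / 2)) *
        s ^ (-1 - α) := by
  have h1 : 0 < 1 - s := by linarith
  have e1 : (1 - s) ^ p = (1 - s) ^ (p - α / 2) * (1 - s) ^ (α / 2) := by
    rw [← Real.rpow_add h1]
    congr 1
    ring
  have e2 : (1 - s) ^ (α - 1 - α / 2) = (1 - s) ^ (p - α / 2) * (1 - s) ^ (α - 1 - p) := by
    rw [← Real.rpow_add h1]
    congr 1
    ring
  simp only [foldedDensity]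
  rw [e1, e2]
  ring

lemma foldedDensity_half_lt {p α s : ℝ} (hp : α / 2 < p) (hs : 0 < s) (hs1 : s < 1) :
    foldedDensity (α / 2) α s < foldedDensity p α s := by
  rw [← sub_pos, foldedDensity_sub_half hs1]
  have h1 : 0 < 1 - s := by linarith
  have h2 : (1 - s) ^ (p - α / 2) < 1 :=
    Real.rpow_lt_one h1.le (by linarith) (by linarith)
  have h3 : (1 - s) ^ (α / 2) < (1 - s) ^ (α - 1 - p) :=
    Real.rpow_lt_rpow_of_exponent_gt h1 (by linarith) (by linarith)
  exact mul_pos (mul_pos (by linarith) (by linarith)) (by positivity)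

lemma integral_foldedDensity_half {α ε : ℝ} (hα : 0 < α) (hε : 0 < ε) (hε1 : ε < 1) :
    ∫ s in Ioo ε 1, foldedDensity (α / 2) α s =
      1 / α - (1 - (1 - ε) ^ (α / 2)) ^ 2 * ε ^ (-α) / α := by
  have hint : IntervalIntegrable (foldedDensity (α / 2) α) volume ε 1 := by
    rw [intervalIntegrable_iff_integrableOn_Ioo_of_le hε1.le]
    exact integrableOn_foldedDensity (by linarith) (by linarith) hε hε1
  rw [← integral_Ioc_eq_integral_Ioo, ← intervalIntegral.integral_of_le hε1.le,
    intervalIntegral.integral_eq_sub_of_hasDerivAt_of_le hε1.le ?_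
      (fun s hs => hasDerivAt_foldedDensity_half hα (hε.trans hs.1) hs.2) hint]
  · simp [Real.zero_rpow (by linarith : α / 2 ≠ 0)]
  · refine ContinuousOn.div_const (ContinuousOn.mul (ContinuousOn.pow (continuousOn_const.sub
      ((continuousOn_const.sub continuousOn_id).rpow_const fun s _ => Or.inr (by linarith))) 2)
      (continuousOn_id.rpow_const fun s hs => Or.inl ?_)) _
    exact (hε.trans_le hs.1).ne'

lemma integral_posPartPowDiff_pos {p α : ℝ} (hα : 0 < α) (hα2 : α < 2) (hp : α / 2 < p)
    (hpα : p < α) : 0 < ∫ t in Ioi 0, posPartPowDiff p t * t ^ (-1 - α) := by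
  have hp0 : 0 < p := by linarith
  set D : ℝ → ℝ := fun s => foldedDensity p α s - foldedDensity (α / 2) α s with hD
  have hDint {ε : ℝ} (hε : 0 < ε) (hε1 : ε < 1) : IntegrableOn D (Ioo ε 1) :=
    (integrableOn_foldedDensity hp0 hpα hε hε1).sub
      (integrableOn_foldedDensity (by linarith) (by linarith) hε hε1)
  have hDpos {s : ℝ} (hs : 0 < s) (hs1 : s < 1) : 0 < D s :=
    sub_pos.2 (foldedDensity_half_lt hp hs hs1)
  have hη : 0 < ∫ s in Ioo (1 / 2) 1, D s := by
    rw [setIntegral_pos_iff_support_of_nonneg_ae _ (hDint (by norm_num) (by norm_num))]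
    · refine lt_of_lt_of_le ?_ (measure_mono (s := Ioo (1 / 2 : ℝ) 1) fun s hs =>
        ⟨(hDpos (lt_trans (by norm_num) hs.1) hs.2).ne', hs⟩)
      rw [Real.volume_Ioo]
      norm_num
    · filter_upwards [ae_restrict_mem measurableSet_Ioo] with s hs
      exact (hDpos (lt_trans (by norm_num) hs.1) hs.2).le
  have hbound : ∀ ε ∈ Ioo (0 : ℝ) (1 / 2), (∫ s in Ioo (1 / 2) 1, D s) - ε ^ (2 - α) / α ≤
      ∫ t in Ioi ε, posPartPowDiff p t * t ^ (-1 - α) := by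
    rintro ε ⟨hε, hεh⟩
    have hε1 : ε < 1 := by linarith
    have h1 := integral_foldedDensity_le hp0 hpα hε hε1
    have h2 : ∫ s in Ioo ε 1, D s = (∫ s in Ioo ε 1, foldedDensity p α s) -
        ∫ s in Ioo ε 1, foldedDensity (α / 2) α s :=
      integral_sub (integrableOn_foldedDensity hp0 hpα hε hε1)
        (integrableOn_foldedDensity (by linarith) (by linarith) hε hε1)
    have h3 : ∫ s in Ioo (1 / 2) 1, D s ≤ ∫ s in Ioo ε 1, D s := by
      refine setIntegral_mono_set (hDint hε hε1) ?_ (Ioo_subset_Ioo_left hεh.le).eventuallyLE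
      filter_upwards [ae_restrict_mem measurableSet_Ioo] with s hs
      exact (hDpos (hε.trans hs.1) hs.2).le
    rw [integral_foldedDensity_half hα hε hε1] at h2
    have h4 : (1 - (1 - ε) ^ (α / 2)) ^ 2 * ε ^ (-α) / α ≤ ε ^ (2 - α) / α := by
      have h5 := Real.rpow_le_rpow_of_exponent_ge (x := 1 - ε) (y := 1) (z := α / 2)
        (by linarith) (by linarith) (by linarith)
      have h6 : (1 - ε) ^ (α / 2) ≤ 1 :=
        Real.rpow_le_one (by linarith) (by linarith) (by linarith)
      rw [Real.rpow_one] at h5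
      have h7 : ε ^ (2 - α) = ε ^ 2 * ε ^ (-α) := by
        rw [sub_eq_add_neg, Real.rpow_add hε]
        norm_cast
      rw [h7]
      gcongr
      linarith
    linarith
  have hlim1 : Tendsto (fun ε : ℝ => ∫ t in Ioi ε, posPartPowDiff p t * t ^ (-1 - α))
      (nhdsWithin 0 (Ioi 0)) (nhds (∫ t in Ioi 0, posPartPowDiff p t * t ^ (-1 - α))) := by
    have h := (aecover_Ioi_of_Ioi (μ := volume) (A := (0 : ℝ))
      (tendsto_id.mono_left nhdsWithin_le_nhds :
        Tendsto id (nhdsWithin 0 (Ioi 0)) (nhds (0 : ℝ)))).integral_tendsto_of_countably_generated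
      (integrableOn_posPartPowDiff_mul_rpow hp0 hα2 hpα)
    refine h.congr' ?_
    filter_upwards [self_mem_nhdsWithin] with ε hε
    rw [id, Measure.restrict_restrict measurableSet_Ioi,
      inter_eq_left.2 (Ioi_subset_Ioi (le_of_lt hε))]
  have hlim2 : Tendsto (fun ε : ℝ => (∫ s in Ioo (1 / 2) 1, D s) - ε ^ (2 - α) / α)
      (nhdsWithin 0 (Ioi 0)) (nhds ((∫ s in Ioo (1 / 2) 1, D s) - 0 ^ (2 - α) / α)) := by
    refine Tendsto.const_sub _ (Tendsto.div_const ?_ _)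
    exact (Real.continuousAt_rpow_const 0 (2 - α) (Or.inr (by linarith))).tendsto.mono_left
      nhdsWithin_le_nhds
  rw [Real.zero_rpow (by linarith), zero_div, sub_zero] at hlim2
  refine hη.trans_le (le_of_tendsto_of_tendsto hlim2 hlim1 ?_)
  filter_upwards [Ioo_mem_nhdsGT (by norm_num : (0 : ℝ) < 1 / 2)] with ε hε
  exact hbound ε hε

/-- The symmetrized integrand of the fractional Laplacian of `w_p` at a point with `x_i = 1`. -/
noncomputable def symKernel {d : ℕ} (i : Fin d) (p α : ℝ) (z : EuclideanSpace ℝ (Fin d)) : ℝ :=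
  posPartPowDiff p (z i) / ‖z‖ ^ ((d : ℝ) + α)

lemma nontrivial_euclideanSpace_of_fin {d : ℕ} (i : Fin d) :
    Nontrivial (EuclideanSpace ℝ (Fin d)) :=
  Module.nontrivial_of_finrank_pos (R := ℝ) (by simpa using i.pos)

lemma pow_mul_div_rpow_add {d : ℕ} (hd : 0 < d) {α r : ℝ} (hr : 0 < r) (s : ℝ) :
    r ^ (d - 1) * (s / r ^ ((d : ℝ) + α)) = s * r ^ (-1 - α) := by
  rw [← Real.rpow_natCast, Nat.cast_pred hd, div_eq_mul_inv, ← Real.rpow_neg hr.le,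
    mul_left_comm, ← Real.rpow_add hr]
  congr 2
  ring

lemma measurable_symKernel {d : ℕ} (i : Fin d) (p α : ℝ) : Measurable (symKernel i p α) := by
  unfold symKernel
  fun_prop

lemma integrable_symKernel {d : ℕ} (i : Fin d) {p α : ℝ} (hp : 0 < p) (hα : α < 2)
    (hpα : p < α) : Integrable (symKernel i p α) := by
  have := nontrivial_euclideanSpace_of_fin i
  have hrad : Integrable (fun z : EuclideanSpace ℝ (Fin d) =>
      sqRpowMajorant p ‖z‖ / ‖z‖ ^ ((d : ℝ) + α)) := by
    refine (integrable_fun_norm_addHaar volume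
      (f := fun r => sqRpowMajorant p r / r ^ ((d : ℝ) + α))).2 ?_
    rw [finrank_euclideanSpace_fin]
    refine (integrableOn_sqRpowMajorant hα hpα).congr_fun (fun r hr => ?_) measurableSet_Ioi
    exact (pow_mul_div_rpow_add i.pos hr _).symm
  refine (hrad.const_mul 6).mono' (measurable_symKernel i p α).aestronglyMeasurable
    (ae_of_all _ fun z => ?_)
  rw [symKernel, norm_div, Real.norm_of_nonneg (r := ‖z‖ ^ ((d : ℝ) + α)) (by positivity),
    ← mul_div_assoc]
  gcongr
  exact abs_posPartPowDiff_le_majorant hp (hpα.trans hα) (PiLp.norm_apply_le z i)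

lemma integral_posPartPowDiff_mul {p α c : ℝ} (hα : 0 < α) (hc : 0 ≤ c) :
    ∫ r in Ioi 0, posPartPowDiff p (r * c) * r ^ (-1 - α) =
      c ^ α * ∫ t in Ioi 0, posPartPowDiff p t * t ^ (-1 - α) := by
  rcases hc.eq_or_lt with rfl | hc
  · rw [Real.zero_rpow hα.ne', zero_mul]
    simp [posPartPowDiff, one_add_one_eq_two]
  · have h := integral_comp_mul_left_Ioi (fun t => posPartPowDiff p t * t ^ (-1 - α)) 0 hc
    rw [mul_zero, smul_eq_mul] at h
    have hcongr : EqOn (fun r : ℝ => posPartPowDiff p (r * c) * r ^ (-1 - α))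
        (fun r => c ^ (1 + α) * (posPartPowDiff p (c * r) * (c * r) ^ (-1 - α))) (Ioi 0) := by
      intro r hr
      have hcc : c ^ (1 + α) * c ^ (-1 - α) = 1 := by
        rw [← Real.rpow_add hc, show 1 + α + (-1 - α) = 0 by ring, Real.rpow_zero]
      simp only [Real.mul_rpow hc.le (le_of_lt (mem_Ioi.1 hr)), mul_comm r c]
      linear_combination (-posPartPowDiff p (c * r) * r ^ (-1 - α)) * hcc
    rw [setIntegral_congr_fun measurableSet_Ioi hcongr, integral_const_mul, h, ← mul_assoc,
      Real.rpow_one_add' hc.le (by linarith)]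
    congr 1
    field_simp

lemma integral_volumeIoiPow (n : ℕ) (f : ℝ → ℝ) :
    ∫ r : Ioi (0 : ℝ), f r ∂(Measure.volumeIoiPow n) = ∫ r in Ioi 0, r ^ n * f r := by
  simp only [Measure.volumeIoiPow, ENNReal.ofReal]
  rw [integral_withDensity_eq_integral_smul,
    integral_subtype_comap measurableSet_Ioi fun a ↦ Real.toNNReal (a ^ n) • f a,
    setIntegral_congr_fun measurableSet_Ioi fun r hr ↦ ?_]
  · rw [NNReal.smul_def, Real.coe_toNNReal _ (pow_nonneg hr.out.le _), smul_eq_mul]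
  · exact (measurable_subtype_coe.pow_const _).real_toNNReal

lemma integral_symKernel_pos {d : ℕ} (i : Fin d) {p α : ℝ} (hα : 0 < α) (hα2 : α < 2)
    (hp : α / 2 < p) (hpα : p < α) : 0 < ∫ z, symKernel i p α z := by
  have := nontrivial_euclideanSpace_of_fin i
  have hK := integrable_symKernel i (by linarith : 0 < p) hα2 hpα
  let μ : Measure (EuclideanSpace ℝ (Fin d)) := volume
  have hfr : Module.finrank ℝ (EuclideanSpace ℝ (Fin d)) = d := finrank_euclideanSpace_fin
  have hmp := μ.measurePreserving_homeomorphUnitSphereProd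
  have hemb : MeasurableEmbedding (homeomorphUnitSphereProd (EuclideanSpace ℝ (Fin d))) :=
    Homeomorph.measurableEmbedding _
  set F : Metric.sphere (0 : EuclideanSpace ℝ (Fin d)) 1 × Ioi (0 : ℝ) → ℝ :=
    fun q => posPartPowDiff p (q.2 * |q.1.1 i|) / (q.2 : ℝ) ^ ((d : ℝ) + α) with hF
  have hFK (z : ({0}ᶜ : Set (EuclideanSpace ℝ (Fin d)))) :
      F (homeomorphUnitSphereProd (EuclideanSpace ℝ (Fin d)) z) = symKernel i p α z := by
    have hz : 0 < ‖(z : EuclideanSpace ℝ (Fin d))‖ := norm_pos_iff.2 z.2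
    simp only [hF, symKernel, homeomorphUnitSphereProd_apply_snd_coe,
      homeomorphUnitSphereProd_apply_fst_coe, PiLp.smul_apply, smul_eq_mul, abs_mul, abs_inv,
      abs_norm, mul_inv_cancel_left₀ hz.ne', posPartPowDiff_abs]
  have hFint : Integrable F
      (μ.toSphere.prod (.volumeIoiPow (Module.finrank ℝ (EuclideanSpace ℝ (Fin d)) - 1))) := by
    rw [← hmp.integrable_comp_emb hemb]
    have : F ∘ homeomorphUnitSphereProd (EuclideanSpace ℝ (Fin d)) =
        symKernel i p α ∘ Subtype.val := funext hFK
    rw [this, ← integrableOn_iff_comap_subtypeVal (measurableSet_singleton _).compl]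
    exact hK.integrableOn
  have hint : ∫ z, symKernel i p α z =
      (∫ θ : Metric.sphere (0 : EuclideanSpace ℝ (Fin d)) 1, |θ.1 i| ^ α ∂μ.toSphere) *
      ∫ t in Ioi 0, posPartPowDiff p t * t ^ (-1 - α) := by
    calc ∫ z, symKernel i p α z
        = ∫ z : ({0}ᶜ : Set (EuclideanSpace ℝ (Fin d))), symKernel i p α z ∂(μ.comap (↑)) := by
          rw [integral_subtype_comap (measurableSet_singleton _).compl (symKernel i p α),
            restrict_compl_singleton]
      _ = ∫ q, F q ∂μ.toSphere.prod
            (.volumeIoiPow (Module.finrank ℝ (EuclideanSpace ℝ (Fin d)) - 1)) := by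
          rw [← hmp.integral_comp hemb F]
          simp only [hFK]
      _ = ∫ θ : Metric.sphere (0 : EuclideanSpace ℝ (Fin d)) 1, (|θ.1 i| ^ α *
            ∫ t in Ioi 0, posPartPowDiff p t * t ^ (-1 - α)) ∂μ.toSphere := by
          rw [integral_prod _ hFint]
          refine integral_congr_ae (ae_of_all _ fun θ => ?_)
          simp only [hF]
          rw [integral_volumeIoiPow _ fun r => posPartPowDiff p (r * |θ.1 i|) /
            r ^ ((d : ℝ) + α), ← integral_posPartPowDiff_mul hα (abs_nonneg _), hfr]
          exact setIntegral_congr_fun measurableSet_Ioi fun r hr =>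
            pow_mul_div_rpow_add i.pos hr _
      _ = _ := integral_mul_const _ _
  rw [hint]
  refine mul_pos ?_ (integral_posPartPowDiff_pos hα hα2 hp hpα)
  have hcont : Continuous fun θ : Metric.sphere (0 : EuclideanSpace ℝ (Fin d)) 1 => |θ.1 i| ^ α := by
    refine Continuous.rpow_const ?_ fun _ => Or.inr hα.le
    fun_prop
  refine hcont.integral_pos_of_hasCompactSupport_nonneg_nonzero
    (HasCompactSupport.of_compactSpace _) (fun θ => by positivity)
    (x := ⟨EuclideanSpace.single i 1, by simp⟩) ?_
  simp

/-- The annulus `{a < ‖z‖ ≤ b}`. -/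
def normAnnulus (d : ℕ) (a b : ℝ) : Set (EuclideanSpace ℝ (Fin d)) :=
  {z | a < ‖z‖ ∧ ‖z‖ ≤ b}

lemma measurableSet_normAnnulus (d : ℕ) (a b : ℝ) : MeasurableSet (normAnnulus d a b) :=
  (measurableSet_lt measurable_const measurable_norm).inter
    (measurableSet_le measurable_norm measurable_const)

lemma integrableOn_normAnnulus {d : ℕ} (i : Fin d) {p α a : ℝ} (hp : 0 < p) (hα : 0 < α)
    (ha : 0 < a) (b : ℝ) :
    IntegrableOn (fun z : EuclideanSpace ℝ (Fin d) =>
      ((max (1 + z i) 0) ^ p - 1) / ‖z‖ ^ ((d : ℝ) + α)) (normAnnulus d a b) := by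
  refine Measure.integrableOn_of_bounded (M := (1 + b) ^ p / a ^ ((d : ℝ) + α)) ?_
    (Measurable.aestronglyMeasurable (by fun_prop)) ?_
  · exact ne_top_of_le_ne_top measure_closedBall_lt_top.ne
      (measure_mono fun z hz => mem_closedBall_zero_iff.2 hz.2)
  · filter_upwards [ae_restrict_mem (measurableSet_normAnnulus d a b)] with z hz
    have hb : 0 < b := ha.trans (hz.1.trans_le hz.2)
    have hzi : z i ≤ b := (le_abs_self _).trans ((PiLp.norm_apply_le z i).trans hz.2)
    have h1 : (max (1 + z i) 0) ^ p ≤ (1 + b) ^ p :=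
      Real.rpow_le_rpow (le_max_right _ _) (max_le (by linarith) (by linarith)) hp.le
    have h2 : 0 ≤ (max (1 + z i) 0) ^ p := by positivity
    have h3 : 1 ≤ (1 + b) ^ p := Real.one_le_rpow (by linarith) hp.le
    rw [norm_div, Real.norm_of_nonneg (r := ‖z‖ ^ ((d : ℝ) + α)) (by positivity)]
    gcongr
    · rw [Real.norm_eq_abs, abs_le]
      constructor <;> linarith
    · exact hz.1.le

lemma setIntegral_normAnnulus_eq {d : ℕ} (i : Fin d) {p α a : ℝ} (hp : 0 < p) (hα : 0 < α)
    (ha : 0 < a) (b : ℝ) :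
    ∫ z in normAnnulus d a b, ((max (1 + z i) 0) ^ p - 1) / ‖z‖ ^ ((d : ℝ) + α) =
      (∫ z in normAnnulus d a b, symKernel i p α z) / 2 := by
  set f : EuclideanSpace ℝ (Fin d) → ℝ :=
    fun z => ((max (1 + z i) 0) ^ p - 1) / ‖z‖ ^ ((d : ℝ) + α) with hf
  have hS := measurableSet_normAnnulus d a b
  have hint : Integrable ((normAnnulus d a b).indicator f) :=
    (integrable_indicator_iff hS).2 (integrableOn_normAnnulus i hp hα ha b)
  have hsum (z : EuclideanSpace ℝ (Fin d)) : (normAnnulus d a b).indicator (symKernel i p α) z =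
      (normAnnulus d a b).indicator f z + (normAnnulus d a b).indicator f (-z) := by
    have hmem : -z ∈ normAnnulus d a b ↔ z ∈ normAnnulus d a b := by simp [normAnnulus]
    by_cases hz : z ∈ normAnnulus d a b
    · rw [indicator_of_mem hz, indicator_of_mem hz, indicator_of_mem (hmem.2 hz)]
      simp only [hf, symKernel, posPartPowDiff, norm_neg, PiLp.neg_apply, ← sub_eq_add_neg]
      ring
    · rw [indicator_of_notMem hz, indicator_of_notMem hz, indicator_of_notMem (mt hmem.1 hz),
        add_zero]
  rw [← integral_indicator hS, ← integral_indicator hS]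
  simp only [hsum]
  rw [integral_add hint hint.comp_neg, integral_neg_eq_self]
  ring

lemma tendsto_setIntegral_normAnnulus {d : ℕ} (i : Fin d) {K : EuclideanSpace ℝ (Fin d) → ℝ}
    (hK : Integrable K) (b : ℝ) :
    Tendsto (fun a => ∫ z in normAnnulus d a b, K z) (nhdsWithin 0 (Ioi 0))
      (nhds (∫ z in Metric.closedBall 0 b, K z)) := by
  have := nontrivial_euclideanSpace_of_fin i
  have hcover : AECover (volume.restrict (Metric.closedBall (0 : EuclideanSpace ℝ (Fin d)) b))
      (nhdsWithin (0 : ℝ) (Ioi 0)) fun a => {z | a < ‖z‖} := by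
    refine ⟨?_, fun a => measurableSet_lt measurable_const measurable_norm⟩
    refine ae_restrict_of_ae ?_
    filter_upwards [(measure_eq_zero_iff_ae_notMem.1 (measure_singleton 0) :
      ∀ᵐ z : EuclideanSpace ℝ (Fin d), z ∉ ({0} : Set _))] with z hz
    exact nhdsWithin_le_nhds (eventually_lt_nhds (norm_pos_iff.2 hz))
  refine (hcover.integral_tendsto_of_countably_generated hK.integrableOn).congr fun a => ?_
  rw [Measure.restrict_restrict (hcover.measurableSet a)]
  congr 2
  ext z
  simp [normAnnulus]

lemma tendsto_setIntegral_closedBall_atTop {d : ℕ} {K : EuclideanSpace ℝ (Fin d) → ℝ}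
    (hK : Integrable K) :
    Tendsto (fun b => ∫ z in Metric.closedBall 0 b, K z) atTop (nhds (∫ z, K z)) :=
  (aecover_closedBall tendsto_id).integral_tendsto_of_countably_generated hK

lemma pvIntTr_posPart_rpow_eq {d : ℕ} (i : Fin d) {p α : ℝ} (x : EuclideanSpace ℝ (Fin d))
    (hx : 0 < x i) (ε : ℝ) :
    pvIntTr d α (fun y => (max (y i) 0) ^ p) x ε = x i ^ (p - α) *
      ∫ z in normAnnulus d (ε / x i) (1 / x i),
        ((max (1 + z i) 0) ^ p - 1) / ‖z‖ ^ ((d : ℝ) + α) := by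
  set r := x i with hr
  set S : Set (EuclideanSpace ℝ (Fin d)) := {y | ε < dist y x ∧ dist y x ≤ 1} with hS
  have hSm : MeasurableSet S :=
    (measurableSet_lt measurable_const (measurable_id.dist measurable_const)).inter
      (measurableSet_le (measurable_id.dist measurable_const) measurable_const)
  set h : EuclideanSpace ℝ (Fin d) → ℝ :=
    fun y => ((max (y i) 0) ^ p - (max (x i) 0) ^ p) / dist x y ^ ((d : ℝ) + α) with hh
  have hscale := Measure.integral_comp_smul_of_nonneg (volume : Measure (EuclideanSpace ℝ (Fin d)))
    (fun z => S.indicator h (x + z)) r (hR := hx.le)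
  rw [integral_add_left_eq_self (fun y => S.indicator h y) x, finrank_euclideanSpace_fin,
    integral_indicator hSm, smul_eq_mul] at hscale
  have hpt (z : EuclideanSpace ℝ (Fin d)) : S.indicator h (x + r • z) =
      (r ^ d)⁻¹ * r ^ (p - α) * (normAnnulus d (ε / r) (1 / r)).indicator
        (fun z => ((max (1 + z i) 0) ^ p - 1) / ‖z‖ ^ ((d : ℝ) + α)) z := by
    have hdist : dist (x + r • z) x = r * ‖z‖ := by
      rw [dist_eq_norm, add_sub_cancel_left, norm_smul, Real.norm_of_nonneg hx.le]
    have hmem : x + r • z ∈ S ↔ z ∈ normAnnulus d (ε / r) (1 / r) := by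
      simp only [hS, normAnnulus, mem_ofPred_eq, hdist, div_lt_iff₀' hx, le_div_iff₀' hx]
    by_cases hz : z ∈ normAnnulus d (ε / r) (1 / r)
    · rw [indicator_of_mem (hmem.2 hz), indicator_of_mem hz]
      have hmax : max (r + r * z i) 0 = r * max (1 + z i) 0 := by
        rw [mul_max_of_nonneg _ _ hx.le, mul_zero, mul_add, mul_one]
      simp only [hh, dist_comm x, hdist, PiLp.add_apply, PiLp.smul_apply, smul_eq_mul, ← hr, hmax,
        max_eq_left hx.le, Real.mul_rpow hx.le (le_max_right (1 + z i) 0),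
        Real.mul_rpow hx.le (norm_nonneg z)]
      rw [Real.rpow_sub hx, Real.rpow_add hx, Real.rpow_natCast]
      field_simp
    · rw [indicator_of_notMem (mt hmem.1 hz), indicator_of_notMem hz, mul_zero]
  simp only [hpt] at hscale
  rw [integral_const_mul, integral_indicator (measurableSet_normAnnulus _ _ _), mul_assoc] at hscale
  exact (mul_left_cancel₀ (inv_ne_zero (pow_ne_zero d hx.ne')) hscale).symm

lemma fracConst_pos {d : ℕ} {α : ℝ} (hα : 0 < α) (hα2 : α < 2) : 0 < fracConst d α := by
  have h1 : 0 < Real.Gamma (((d : ℝ) + α) / 2) := Real.Gamma_pos_of_pos (by positivity)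
  have h2 : 0 < Real.Gamma (1 - α / 2) := Real.Gamma_pos_of_pos (by linarith)
  unfold fracConst
  positivity

/-- For every `p ∈ (α/2, α)` there exist `R_* ∈ (0,1)` and constants `C ≥ c > 0`
(depending only on p, d, α) so that for every `x` with `0 < x₁ ≤ R_*` the limit defining
the truncated fractional Laplacian `Δ̂^{α/2} w_p(x)` exists and
`c x₁^{p-α} ≤ Δ̂^{α/2} w_p(x) ≤ C x₁^{p-α}`, where `w_p(x) = (x₁⁺)^p`. -/
theorem statement2 (d : ℕ) (hd : 1 ≤ d) (α : ℝ) (hα : α ∈ Set.Ioo (0 : ℝ) 2)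
    (p : ℝ) (hp : p ∈ Set.Ioo (α / 2) α) :
    ∃ R ∈ Set.Ioo (0 : ℝ) 1, ∃ c C : ℝ, 0 < c ∧ c ≤ C ∧
      ∀ x : EuclideanSpace ℝ (Fin d), 0 < x ⟨0, hd⟩ → x ⟨0, hd⟩ ≤ R →
        ∃ L : ℝ,
          Filter.Tendsto (pvIntTr d α (fun y => (max (y ⟨0, hd⟩) 0) ^ p) x)
            (nhdsWithin 0 (Set.Ioi 0)) (nhds L) ∧
          c * (x ⟨0, hd⟩) ^ (p - α) ≤ fracConst d α * L ∧
          fracConst d α * L ≤ C * (x ⟨0, hd⟩) ^ (p - α) := by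
  obtain ⟨hα0, hα2⟩ := hα
  obtain ⟨hp, hpα⟩ := hp
  have hp0 : 0 < p := by linarith
  set i : Fin d := ⟨0, hd⟩
  have hK := integrable_symKernel i hp0 hα2 hpα
  have hA : 0 < fracConst d α := fracConst_pos hα0 hα2
  set J : ℝ := ∫ z, symKernel i p α z with hJ
  have hJ0 : 0 < J := integral_symKernel_pos i hα0 hα2 hp hpα
  obtain ⟨B, hB⟩ := eventually_atTop.1 ((tendsto_setIntegral_closedBall_atTop hK).eventually
    (Icc_mem_nhds (half_lt_self hJ0) (by linarith : J < 2 * J)))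
  have hM : 0 < max B 2 := lt_of_lt_of_le two_pos (le_max_right _ _)
  refine ⟨1 / max B 2, ⟨by positivity, ?_⟩, fracConst d α * (J / 4), fracConst d α * J,
    by positivity, by gcongr; linarith, fun x hx hxR => ?_⟩
  · rw [div_lt_one hM]
    exact lt_of_lt_of_le one_lt_two (le_max_right _ _)
  have hBx : B ≤ 1 / x i := (le_max_left B 2).trans ((le_one_div hM hx).2 hxR)
  obtain ⟨hlow, hupp⟩ := hB _ hBx
  have hpow : 0 < x i ^ (p - α) := by positivity
  refine ⟨x i ^ (p - α) * ((∫ z in Metric.closedBall 0 (1 / x i), symKernel i p α z) / 2),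
    ?_, ?_, ?_⟩
  · have hdiv : Tendsto (fun ε => ε / x i) (nhdsWithin 0 (Ioi 0)) (nhdsWithin 0 (Ioi 0)) := by
      refine tendsto_nhdsWithin_iff.2 ⟨?_, ?_⟩
      · have h := (tendsto_id (x := nhds (0 : ℝ))).div_const (x i)
        rw [zero_div] at h
        exact h.mono_left nhdsWithin_le_nhds
      · filter_upwards [self_mem_nhdsWithin] with ε hε
        exact div_pos hε hx
    refine ((((tendsto_setIntegral_normAnnulus i hK (1 / x i)).comp hdiv).div_const 2).const_mul
      (x i ^ (p - α))).congr' ?_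
    filter_upwards [self_mem_nhdsWithin] with ε hε
    rw [pvIntTr_posPart_rpow_eq i x hx, setIntegral_normAnnulus_eq i hp0 hα0 (div_pos hε hx)]
    rfl
  · calc fracConst d α * (J / 4) * x i ^ (p - α)
        = fracConst d α * (x i ^ (p - α) * (J / 2 / 2)) := by ring
      _ ≤ _ := by gcongr
  · calc fracConst d α * (x i ^ (p - α) *
          ((∫ z in Metric.closedBall 0 (1 / x i), symKernel i p α z) / 2))
        ≤ fracConst d α * (x i ^ (p - α) * (2 * J / 2)) := by gcongr
      _ = fracConst d α * J * x i ^ (p - α) := by ring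
end

section
/- For every integer d ≥ 1 and every α ∈ (0,2), there exist constants R_* ∈ (0,1) and C > 0, depending only on d and α, such that for every x ∈ ℝ^d with 0 < x_1 ≤ R_*, the limit defining the truncated fractional Laplacian Δ̂^{α/2} w_α(x) exists and |Δ̂^{α/2} w_α(x)| ≤ C · |log x_1|. -/
open MeasureTheory Filter Set

/-- The symmetric second difference of `(·⁺)^α` at `a` with step `t`. -/
noncomputable def secondDiffPosPow (α a t : ℝ) : ℝ :=
  max (a + t) 0 ^ α + max (a - t) 0 ^ α - 2 * a ^ α

theorem abs_one_add_rpow_sub_one_sub_rpow_le {β s : ℝ} (hβ : β ∈ Ioo (-1 : ℝ) 1)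
    (hs : s ∈ Icc (0 : ℝ) (1 / 2)) : |(1 + s) ^ β - (1 - s) ^ β| ≤ 8 * s := by
  obtain ⟨hβ₁, hβ₂⟩ := hβ
  obtain ⟨hs₁, hs₂⟩ := hs
  have hderiv : ∀ x ∈ Ici (1 / 2 : ℝ),
      HasDerivWithinAt (fun x : ℝ => x ^ β) (β * x ^ (β - 1)) (Ici (1 / 2)) x := fun x hx =>
    (Real.hasDerivAt_rpow_const (Or.inl (by have := mem_Ici.1 hx; linarith))).hasDerivWithinAt
  have hbound : ∀ x ∈ Ici (1 / 2 : ℝ), ‖β * x ^ (β - 1)‖ ≤ 4 := by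
    intro x hx
    have hx' : (1 / 2 : ℝ) ≤ x := hx
    have hx0 : 0 < x := by linarith
    have h₁ : x ^ (β - 1) ≤ (1 / 2 : ℝ) ^ (β - 1) :=
      Real.rpow_le_rpow_of_nonpos (by norm_num) hx' (by linarith)
    have h₂ : (1 / 2 : ℝ) ^ (β - 1) ≤ (1 / 2 : ℝ) ^ (-2 : ℝ) :=
      Real.rpow_le_rpow_of_exponent_ge (by norm_num) (by norm_num) (by linarith)
    have h₃ : (1 / 2 : ℝ) ^ (-2 : ℝ) = 4 := by
      rw [Real.rpow_neg (by norm_num)]; norm_num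
    have h₄ : 0 < x ^ (β - 1) := Real.rpow_pos_of_pos hx0 _
    rw [norm_mul, Real.norm_eq_abs, Real.norm_eq_abs, abs_of_pos h₄]
    have h₅ : |β| ≤ 1 := abs_le.2 ⟨hβ₁.le, hβ₂.le⟩
    nlinarith
  have := (convex_Ici (1 / 2 : ℝ)).norm_image_sub_le_of_norm_hasDerivWithin_le
    (x := 1 - s) (y := 1 + s) hderiv hbound (mem_Ici.2 (by linarith)) (mem_Ici.2 (by linarith))
  rw [Real.norm_eq_abs, Real.norm_eq_abs, abs_of_nonneg (by linarith : 0 ≤ 1 + s - (1 - s))] at this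
  linarith

theorem abs_one_add_rpow_add_one_sub_rpow_sub_two_le {α t : ℝ} (hα : α ∈ Ioo (0 : ℝ) 2)
    (ht : t ∈ Icc (0 : ℝ) 1) : |(1 + t) ^ α + (1 - t) ^ α - 2| ≤ 16 * t ^ 2 := by
  obtain ⟨hα₁, hα₂⟩ := hα
  obtain ⟨ht₁, ht₂⟩ := ht
  rcases le_total t (1 / 2) with h | h
  · have hderiv : ∀ x ∈ Icc (0 : ℝ) t, HasDerivWithinAt
        (fun x : ℝ => (1 + x) ^ α + (1 - x) ^ α - 2)
        (α * ((1 + x) ^ (α - 1) - (1 - x) ^ (α - 1))) (Icc 0 t) x := by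
      intro x hx
      have h₁ := ((hasDerivAt_id x).const_add 1).rpow_const (p := α)
        (Or.inl (by have := hx.1; simp only [id]; linarith))
      have h₂ := ((hasDerivAt_id x).const_sub 1).rpow_const (p := α)
        (Or.inl (by have := hx.2; simp only [id]; linarith))
      refine (((h₁.add h₂).sub_const 2).congr_deriv ?_).hasDerivWithinAt
      simp only [id]; ring
    have hbound : ∀ x ∈ Icc (0 : ℝ) t,
        ‖α * ((1 + x) ^ (α - 1) - (1 - x) ^ (α - 1))‖ ≤ 16 * t := by
      intro x hx
      have := abs_one_add_rpow_sub_one_sub_rpow_le (β := α - 1) (s := x)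
        ⟨by linarith, by linarith⟩ ⟨hx.1, hx.2.trans h⟩
      rw [norm_mul, Real.norm_eq_abs, Real.norm_eq_abs, abs_of_pos hα₁]
      have h₀ := abs_nonneg ((1 + x) ^ (α - 1) - (1 - x) ^ (α - 1))
      nlinarith [hx.2]
    have := (convex_Icc 0 t).norm_image_sub_le_of_norm_hasDerivWithin_le
      hderiv hbound (left_mem_Icc.2 ht₁) (right_mem_Icc.2 ht₁)
    simp only [add_zero, sub_zero, Real.one_rpow, Real.norm_eq_abs, abs_of_nonneg ht₁] at this
    calc _ = |(1 + t) ^ α + (1 - t) ^ α - 2 - (1 + 1 - 2)| := by norm_num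
      _ ≤ _ := this
      _ = _ := by ring
  · have h₁ : (1 + t) ^ α ≤ 4 := by
      calc (1 + t) ^ α ≤ (1 + t) ^ (2 : ℝ) :=
            Real.rpow_le_rpow_of_exponent_le (by linarith) hα₂.le
        _ ≤ 4 := by norm_num; nlinarith
    have h₂ : (1 - t) ^ α ≤ 1 := Real.rpow_le_one (by linarith) (by linarith) hα₁.le
    have h₃ : 0 ≤ (1 + t) ^ α := by positivity
    have h₄ : 0 ≤ (1 - t) ^ α := Real.rpow_nonneg (by linarith) _
    rw [abs_le]
    constructor <;> nlinarith

theorem abs_secondDiffPosPow_le_sq {α a t : ℝ} (hα : α ∈ Ioo (0 : ℝ) 2) (ha : 0 < a)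
    (ht : |t| ≤ a) : |secondDiffPosPow α a t| ≤ 16 * (a ^ (α - 2) * t ^ 2) := by
  have key : secondDiffPosPow α a t = a ^ α * ((1 + |t| / a) ^ α + (1 - |t| / a) ^ α - 2) := by
    have h₁ : 0 ≤ 1 - |t| / a := by rw [sub_nonneg, div_le_one ha]; exact ht
    have h₂ : 0 ≤ 1 + |t| / a := by positivity
    rw [mul_sub, mul_add, ← Real.mul_rpow ha.le h₂, ← Real.mul_rpow ha.le h₁, mul_add, mul_sub,
      mul_div_cancel₀ _ ha.ne', mul_one, secondDiffPosPow]
    rcases abs_cases t with ⟨h, _⟩ | ⟨h, _⟩ <;> rw [h] at ht ⊢ <;>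
      rw [max_eq_left (by linarith), max_eq_left (by linarith)]
    · ring
    · rw [sub_neg_eq_add, ← sub_eq_add_neg]; ring
  have hb := abs_one_add_rpow_add_one_sub_rpow_sub_two_le (t := |t| / a) hα
    ⟨by positivity, (div_le_one ha).2 ht⟩
  rw [key, abs_mul, abs_of_pos (Real.rpow_pos_of_pos ha α)]
  calc _ ≤ a ^ α * (16 * (|t| / a) ^ 2) := by gcongr
    _ = _ := by
      rw [div_pow, sq_abs, Real.rpow_sub ha, Real.rpow_two]; ring

theorem abs_secondDiffPosPow_le_rpow {α a t r : ℝ} (hα : α ∈ Ioo (0 : ℝ) 2) (ha : 0 < a)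
    (har : a ≤ r) (ht : |t| ≤ r) : |secondDiffPosPow α a t| ≤ 16 * r ^ α := by
  have hr : 0 < r := ha.trans_le har
  obtain ⟨ht₁, ht₂⟩ := abs_le.1 ht
  have h2 : (2 * r) ^ α ≤ 4 * r ^ α := by
    rw [Real.mul_rpow (by norm_num) hr.le]
    gcongr
    calc (2 : ℝ) ^ α ≤ 2 ^ (2 : ℝ) := Real.rpow_le_rpow_of_exponent_le (by norm_num) hα.2.le
      _ = 4 := by norm_num
  have h3 : a ^ α ≤ r ^ α := Real.rpow_le_rpow ha.le har hα.1.le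
  have h4 : 0 ≤ a ^ α := by positivity
  have h : ∀ v ≤ 2 * r, 0 ≤ max v 0 ^ α ∧ max v 0 ^ α ≤ (2 * r) ^ α := fun v hv =>
    ⟨Real.rpow_nonneg (le_max_right _ _) _,
      Real.rpow_le_rpow (le_max_right _ _) (max_le hv (by positivity)) hα.1.le⟩
  have h5 := h (a + t) (by linarith)
  have h6 := h (a - t) (by linarith)
  rw [secondDiffPosPow, abs_le]
  constructor <;> linarith

/-- A radial profile dominating the symmetrized integrand. -/
noncomputable def radialMajorant (d : ℕ) (α a r : ℝ) : ℝ :=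
  (Ioc 0 a).indicator (fun r => a ^ (α - 2) * r ^ (2 - ((d : ℝ) + α))) r +
    (Ioc a 1).indicator (fun r => r ^ (-(d : ℝ))) r

theorem radialMajorant_nonneg (d : ℕ) (α : ℝ) {a : ℝ} (ha : 0 < a) (r : ℝ) :
    0 ≤ radialMajorant d α a r := by
  refine add_nonneg (indicator_nonneg (fun s hs => ?_) r) (indicator_nonneg (fun s hs => ?_) r)
  · have := hs.1
    positivity
  · have := ha.trans hs.1
    positivity

theorem abs_secondDiffPosPow_div_le_radialMajorant (d : ℕ) {α a t r : ℝ}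
    (hα : α ∈ Ioo (0 : ℝ) 2) (ha : 0 < a) (hr : r ∈ Ioc 0 1) (ht : |t| ≤ r) :
    |secondDiffPosPow α a t / r ^ ((d : ℝ) + α)| ≤ 16 * radialMajorant d α a r := by
  obtain ⟨hr₀, hr₁⟩ := hr
  have hp : 0 < r ^ ((d : ℝ) + α) := Real.rpow_pos_of_pos hr₀ _
  rw [abs_div, abs_of_pos hp, div_le_iff₀ hp, radialMajorant]
  rcases le_or_gt r a with h | h
  · rw [indicator_of_mem (mem_Ioc.2 ⟨hr₀, h⟩), indicator_of_notMem (fun h' => h'.1.not_ge h),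
      add_zero, mul_assoc, mul_assoc, ← Real.rpow_add hr₀, sub_add_cancel, Real.rpow_two]
    refine (abs_secondDiffPosPow_le_sq hα ha (ht.trans h)).trans ?_
    have : t ^ 2 ≤ r ^ 2 := by rw [← sq_abs]; gcongr
    gcongr
  · rw [indicator_of_notMem (fun h' => h'.2.not_gt h), indicator_of_mem (mem_Ioc.2 ⟨h, hr₁⟩),
      zero_add, mul_assoc, ← Real.rpow_add hr₀, neg_add_cancel_left]
    exact abs_secondDiffPosPow_le_rpow hα ha h.le ht

theorem pow_smul_radialMajorant {d : ℕ} (hd : 1 ≤ d) (α : ℝ) {a : ℝ} (ha : 0 < a) (r : ℝ) :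
    r ^ (d - 1) • radialMajorant d α a r =
      (Ioc 0 a).indicator (fun r => a ^ (α - 2) * r ^ (1 - α)) r +
        (Ioc a 1).indicator (fun r => r⁻¹) r := by
  have hpow : ∀ s : ℝ, s ^ (d - 1) = s ^ ((d : ℝ) - 1) := fun s => by
    rw [← Real.rpow_natCast, Nat.cast_sub hd, Nat.cast_one]
  rw [radialMajorant, smul_eq_mul, mul_add]
  congr 1
  · by_cases h : r ∈ Ioc 0 a
    · rw [indicator_of_mem h, indicator_of_mem h, hpow, mul_left_comm, ← Real.rpow_add h.1]
      ring_nf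
    · rw [indicator_of_notMem h, indicator_of_notMem h, mul_zero]
  · by_cases h : r ∈ Ioc a 1
    · rw [indicator_of_mem h, indicator_of_mem h, hpow, ← Real.rpow_add (ha.trans h.1),
        ← Real.rpow_neg_one]
      ring_nf
    · rw [indicator_of_notMem h, indicator_of_notMem h, mul_zero]

theorem integrableOn_mul_rpow_Ioc {α a : ℝ} (hα : α < 2) (ha : 0 < a) :
    IntegrableOn (fun r : ℝ => a ^ (α - 2) * r ^ (1 - α)) (Ioc 0 a) :=
  Integrable.const_mul ((intervalIntegrable_iff_integrableOn_Ioc_of_le ha.le).1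
    (intervalIntegral.intervalIntegrable_rpow' (by linarith))) _

theorem integrableOn_inv_Ioc {a : ℝ} (ha : 0 < a) (ha₁ : a ≤ 1) :
    IntegrableOn (fun r : ℝ => r⁻¹) (Ioc a 1) := by
  refine (intervalIntegrable_iff_integrableOn_Ioc_of_le ha₁).1
    (intervalIntegral.intervalIntegrable_inv (fun x hx => ?_) continuousOn_id)
  rw [uIcc_of_le ha₁] at hx
  exact (ha.trans_le hx.1).ne'

theorem integrableOn_pow_smul_radialMajorant {d : ℕ} (hd : 1 ≤ d) {α a : ℝ} (hα : α < 2)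
    (ha : 0 < a) (ha₁ : a ≤ 1) :
    IntegrableOn (fun r : ℝ => r ^ (d - 1) • radialMajorant d α a r) (Ioi 0) := by
  simp_rw [pow_smul_radialMajorant hd α ha]
  exact (((integrableOn_mul_rpow_Ioc hα ha).integrable_indicator measurableSet_Ioc).add
    ((integrableOn_inv_Ioc ha ha₁).integrable_indicator measurableSet_Ioc)).integrableOn

theorem integral_pow_smul_radialMajorant {d : ℕ} (hd : 1 ≤ d) {α a : ℝ} (hα : α < 2)
    (ha : 0 < a) (ha₁ : a ≤ 1) :
    ∫ r in Ioi 0, r ^ (d - 1) • radialMajorant d α a r = 1 / (2 - α) + |Real.log a| := by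
  simp_rw [pow_smul_radialMajorant hd α ha]
  rw [integral_add
      ((integrableOn_mul_rpow_Ioc hα ha).integrable_indicator measurableSet_Ioc).integrableOn
      ((integrableOn_inv_Ioc ha ha₁).integrable_indicator measurableSet_Ioc).integrableOn,
    setIntegral_indicator measurableSet_Ioc, setIntegral_indicator measurableSet_Ioc,
    inter_eq_right.2 Ioc_subset_Ioi_self,
    inter_eq_right.2 (Ioc_subset_Ioi_self.trans (Ioi_subset_Ioi ha.le)),
    integral_const_mul, ← intervalIntegral.integral_of_le ha.le,
    ← intervalIntegral.integral_of_le ha₁, integral_rpow (Or.inl (by linarith)),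
    integral_inv_of_pos ha one_pos, one_div, Real.log_inv,
    abs_of_nonpos (Real.log_nonpos ha.le ha₁)]
  congr 1
  rw [Real.zero_rpow (by linarith), sub_zero, mul_div_assoc', ← Real.rpow_add ha]
  ring_nf
  simp

theorem pvIntTr_eq_integral_secondDiffPosPow {d : ℕ} (i : Fin d) {α : ℝ} (hα : 0 < α)
    (x : EuclideanSpace ℝ (Fin d)) (hx : 0 ≤ x i) {ε : ℝ} (hε : 0 < ε) :
    pvIntTr d α (fun y => max (y i) 0 ^ α) x ε =
      ∫ z : EuclideanSpace ℝ (Fin d), {z | ε < ‖z‖ ∧ ‖z‖ ≤ 1}.indicator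
        (fun z => 2⁻¹ * (secondDiffPosPow α (x i) (z i) / ‖z‖ ^ ((d : ℝ) + α))) z := by
  set S : Set (EuclideanSpace ℝ (Fin d)) := {z | ε < ‖z‖ ∧ ‖z‖ ≤ 1} with hS
  set f : EuclideanSpace ℝ (Fin d) → ℝ :=
    fun z => (max (x i + z i) 0 ^ α - x i ^ α) / ‖z‖ ^ ((d : ℝ) + α) with hf
  have hSm : MeasurableSet S :=
    (measurableSet_lt measurable_const measurable_norm).inter
      (measurableSet_le measurable_norm measurable_const)
  have hfm : Measurable f := by
    have : Measurable fun z : EuclideanSpace ℝ (Fin d) => z i := by fun_prop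
    fun_prop
  have hfi : Integrable (S.indicator f) := by
    rw [integrable_indicator_iff hSm]
    refine Measure.integrableOn_of_bounded (M := ((x i + 1) ^ α + x i ^ α) / ε ^ ((d : ℝ) + α))
      ?_ hfm.aestronglyMeasurable ?_
    · refine ((measure_mono ?_).trans_lt (measure_closedBall_lt_top (x := 0) (r := 1))).ne
      exact fun z hz => by simpa using hz.2
    · refine (ae_restrict_iff' hSm).2 (ae_of_all _ fun z hz => ?_)
      have hz₁ : |z i| ≤ 1 := (PiLp.norm_apply_le z i).trans hz.2
      have hz₂ := (abs_le.1 hz₁).2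
      rw [hf, norm_div, Real.norm_of_nonneg (r := ‖z‖ ^ _) (by positivity)]
      have h₁ : ‖max (x i + z i) 0 ^ α - x i ^ α‖ ≤ (x i + 1) ^ α + x i ^ α := by
        have h₂ : max (x i + z i) 0 ^ α ≤ (x i + 1) ^ α :=
          Real.rpow_le_rpow (le_max_right _ _) (max_le (by linarith) (by linarith)) hα.le
        have h₃ : 0 ≤ max (x i + z i) 0 ^ α := Real.rpow_nonneg (le_max_right _ _) _
        have h₄ : 0 ≤ x i ^ α := Real.rpow_nonneg hx _
        rw [Real.norm_eq_abs, abs_le]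
        constructor <;> linarith
      have h₂ : ε ^ ((d : ℝ) + α) ≤ ‖z‖ ^ ((d : ℝ) + α) :=
        Real.rpow_le_rpow hε.le hz.1.le (by positivity)
      have h₃ : 0 < ε ^ ((d : ℝ) + α) := Real.rpow_pos_of_pos hε _
      exact div_le_div₀ ((norm_nonneg _).trans h₁) h₁ h₃ h₂
  have hT : MeasurableSet {y : EuclideanSpace ℝ (Fin d) | ε < dist y x ∧ dist y x ≤ 1} :=
    (measurableSet_lt measurable_const (measurable_id.dist measurable_const)).inter
      (measurableSet_le (measurable_id.dist measurable_const) measurable_const)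
  have h₁ : pvIntTr d α (fun y => max (y i) 0 ^ α) x ε = ∫ z, S.indicator f z := by
    rw [pvIntTr, ← integral_indicator hT, ← integral_add_right_eq_self _ x]
    congr 1 with z
    simp only [indicator_apply, hS, hf, mem_ofPred_eq, dist_eq_norm, add_sub_cancel_right,
      norm_sub_rev x, PiLp.add_apply, max_eq_left hx, add_comm (z i)]
  have h₂ : ∫ z, S.indicator f z = ∫ z, S.indicator f (-z) :=
    (integral_neg_eq_self (S.indicator f) volume).symm
  calc _ = 2⁻¹ * ((∫ z, S.indicator f z) + ∫ z, S.indicator f (-z)) := by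
        rw [h₁, ← h₂]; ring
    _ = ∫ z, 2⁻¹ * (S.indicator f z + S.indicator f (-z)) := by
        rw [integral_const_mul, integral_add hfi hfi.comp_neg]
    _ = _ := by
        congr 1 with z
        by_cases hz : z ∈ S
        · have hz' : -z ∈ S := by simpa [hS] using hz
          rw [indicator_of_mem hz, indicator_of_mem hz', indicator_of_mem hz]
          simp only [hf, norm_neg, PiLp.neg_apply, secondDiffPosPow, ← sub_eq_add_neg]
          ring
        · have hz' : -z ∉ S := by simpa [hS] using hz
          rw [indicator_of_notMem hz, indicator_of_notMem hz', indicator_of_notMem hz]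
          ring

/-- There exist `R_* ∈ (0,1)` and `C > 0` (depending only on d, α) such that for every
`x` with `0 < x₁ ≤ R_*`, the limit defining `Δ̂^{α/2} w_α(x)` exists and
`|Δ̂^{α/2} w_α(x)| ≤ C |log x₁|`, where `w_α(x) = (x₁⁺)^α`. -/
theorem statement3 (d : ℕ) (hd : 1 ≤ d) (α : ℝ) (hα : α ∈ Set.Ioo (0 : ℝ) 2) :
    ∃ R ∈ Set.Ioo (0 : ℝ) 1, ∃ C : ℝ, 0 < C ∧
      ∀ x : EuclideanSpace ℝ (Fin d), 0 < x ⟨0, hd⟩ → x ⟨0, hd⟩ ≤ R →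
        ∃ L : ℝ,
          Filter.Tendsto (pvIntTr d α (fun y => (max (y ⟨0, hd⟩) 0) ^ α) x)
            (nhdsWithin 0 (Set.Ioi 0)) (nhds L) ∧
          |fracConst d α * L| ≤ C * |Real.log (x ⟨0, hd⟩)| := by
  have : Nontrivial (EuclideanSpace ℝ (Fin d)) :=
    Module.nontrivial_of_finrank_pos (R := ℝ) (by rw [finrank_euclideanSpace_fin]; exact hd)
  set v : ℝ := volume.real (Metric.ball (0 : EuclideanSpace ℝ (Fin d)) 1)
  have h2α : 0 < 2 - α := sub_pos.2 hα.2
  refine ⟨1 / 2, by norm_num, |fracConst d α| * (8 * (d * (v * (2 / (2 - α) + 1)))) + 1,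
    by positivity, fun x hx₀ hxR => ?_⟩
  generalize (⟨0, hd⟩ : Fin d) = i at *
  set a := x i with ha
  have ha₁ : a ≤ 1 := by linarith
  set g : EuclideanSpace ℝ (Fin d) → ℝ :=
    fun z => 2⁻¹ * (secondDiffPosPow α a (z i) / ‖z‖ ^ ((d : ℝ) + α)) with hg
  have hgm : Measurable g := by
    have : Measurable fun z : EuclideanSpace ℝ (Fin d) => z i := by fun_prop
    simp only [hg, secondDiffPosPow]
    fun_prop
  have hSm : ∀ ε : ℝ, MeasurableSet {z : EuclideanSpace ℝ (Fin d) | ε < ‖z‖ ∧ ‖z‖ ≤ 1} :=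
    fun ε => (measurableSet_lt measurable_const measurable_norm).inter
      (measurableSet_le measurable_norm measurable_const)
  have hint : Integrable
      (fun z : EuclideanSpace ℝ (Fin d) => 8 * radialMajorant d α a ‖z‖) := by
    refine Integrable.const_mul ((integrable_fun_norm_addHaar volume).2 ?_) 8
    rw [finrank_euclideanSpace_fin]
    exact integrableOn_pow_smul_radialMajorant hd hα.2 hx₀ ha₁
  have hdom : ∀ ε : ℝ, 0 ≤ ε → ∀ z : EuclideanSpace ℝ (Fin d),
      ‖{z : EuclideanSpace ℝ (Fin d) | ε < ‖z‖ ∧ ‖z‖ ≤ 1}.indicator g z‖ ≤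
        8 * radialMajorant d α a ‖z‖ := by
    intro ε hε z
    by_cases hz : ε < ‖z‖ ∧ ‖z‖ ≤ 1
    · rw [indicator_of_mem (by exact hz), hg, norm_mul, Real.norm_eq_abs, Real.norm_eq_abs]
      have := abs_secondDiffPosPow_div_le_radialMajorant d hα hx₀
        ⟨hε.trans_lt hz.1, hz.2⟩ (PiLp.norm_apply_le z i)
      rw [abs_of_pos (by norm_num : (0 : ℝ) < 2⁻¹)]
      linarith
    · rw [indicator_of_notMem (by exact hz), norm_zero]
      exact mul_nonneg (by norm_num) (radialMajorant_nonneg d α hx₀ _)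
  refine ⟨∫ z, {z : EuclideanSpace ℝ (Fin d) | 0 < ‖z‖ ∧ ‖z‖ ≤ 1}.indicator g z, ?_, ?_⟩
  · have hlim : Tendsto (fun ε : ℝ =>
        ∫ z, {z : EuclideanSpace ℝ (Fin d) | ε < ‖z‖ ∧ ‖z‖ ≤ 1}.indicator g z)
        (nhdsWithin 0 (Ioi 0))
        (nhds (∫ z, {z : EuclideanSpace ℝ (Fin d) | 0 < ‖z‖ ∧ ‖z‖ ≤ 1}.indicator g z)) := by
      refine tendsto_integral_filter_of_dominated_convergence _
        (.of_forall fun ε => (hgm.indicator (hSm ε)).aestronglyMeasurable)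
        (eventually_mem_nhdsWithin.mono fun ε hε => ae_of_all _ (hdom ε (le_of_lt hε)))
        hint (ae_of_all _ fun z => tendsto_const_nhds.congr' ?_)
      rcases (norm_nonneg z).eq_or_lt with hz | hz
      · filter_upwards [eventually_mem_nhdsWithin] with ε hε
        rw [indicator_of_notMem, indicator_of_notMem]
        · exact fun h => (h.1.trans_eq hz.symm).not_gt hε
        · exact fun h => h.1.ne hz
      · filter_upwards [nhdsWithin_le_nhds (Iio_mem_nhds hz)] with ε hε
        simp only [indicator_apply, mem_ofPred_eq, hz, mem_Iio.1 hε, true_and]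
    refine hlim.congr' ?_
    filter_upwards [eventually_mem_nhdsWithin] with ε hε
    exact (pvIntTr_eq_integral_secondDiffPosPow i hα.1 x hx₀.le hε).symm
  · have hL : |∫ z, {z : EuclideanSpace ℝ (Fin d) | 0 < ‖z‖ ∧ ‖z‖ ≤ 1}.indicator g z| ≤
        8 * (d * (v * (1 / (2 - α) + |Real.log a|))) := by
      refine (norm_integral_le_of_norm_le hint (ae_of_all _ (hdom 0 le_rfl))).trans_eq ?_
      rw [integral_const_mul, integral_fun_norm_addHaar, finrank_euclideanSpace_fin,
        integral_pow_smul_radialMajorant hd hα.2 hx₀ ha₁, nsmul_eq_mul, smul_eq_mul]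
    have hlog : 1 / 2 ≤ |Real.log a| := by
      have := Real.log_le_log hx₀ hxR
      rw [one_div, Real.log_inv] at this
      have := neg_le_abs (Real.log a)
      linarith [Real.log_two_gt_d9]
    have h₁ : 1 / (2 - α) ≤ 2 / (2 - α) * |Real.log a| := by
      calc 1 / (2 - α) = 2 / (2 - α) * (1 / 2) := by ring
        _ ≤ _ := by gcongr
    rw [abs_mul]
    calc _ ≤ |fracConst d α| *
          (8 * (d * (v * (2 / (2 - α) * |Real.log a| + |Real.log a|)))) := by
          refine mul_le_mul_of_nonneg_left (hL.trans ?_) (abs_nonneg _)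
          gcongr
      _ ≤ _ := by nlinarith [abs_nonneg (Real.log a)]
end

section
/- For every integer d ≥ 1, every α ∈ (0,2) and every p > α, there exist constants R_* ∈ (0,1) and C > 0, depending only on p, d and α, such that for every x ∈ ℝ^d with 0 < x_1 ≤ R_*, the limit defining the truncated fractional Laplacian Δ̂^{α/2} w_p(x) exists and |Δ̂^{α/2} w_p(x)| ≤ C. -/
open MeasureTheory Filter Set

/-- The positive part raised to a power `β > 0` is locally `min β 1`-Hölder. -/
lemma exists_abs_max_rpow_sub_le {β : ℝ} (hβ : 0 < β) :
    ∃ C : ℝ, 0 ≤ C ∧ ∀ a b : ℝ, a ≤ 2 → b ≤ 2 →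
      |max a 0 ^ β - max b 0 ^ β| ≤ C * |a - b| ^ min β 1 := by
  rcases le_total β 1 with h1 | h1
  · refine ⟨1, zero_le_one, fun a b _ _ => ?_⟩
    rw [min_eq_left h1, one_mul]
    have key : ∀ x y : ℝ, 0 ≤ x → 0 ≤ y → x ^ β - y ^ β ≤ |x - y| ^ β := by
      intro x y hx hy
      have h := Real.rpow_add_le_add_rpow (abs_nonneg (x - y)) hy hβ.le h1
      have h' : x ^ β ≤ (|x - y| + y) ^ β :=
        Real.rpow_le_rpow hx (by linarith [le_abs_self (x - y)]) hβ.le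
      linarith
    calc |max a 0 ^ β - max b 0 ^ β| ≤ |max a 0 - max b 0| ^ β := by
          refine abs_sub_le_iff.2 ⟨key _ _ (le_max_right _ _) (le_max_right _ _), ?_⟩
          rw [abs_sub_comm]
          exact key _ _ (le_max_right _ _) (le_max_right _ _)
      _ ≤ |a - b| ^ β :=
          Real.rpow_le_rpow (abs_nonneg _) (abs_max_sub_max_le_abs a b 0) hβ.le
  · refine ⟨β * 2 ^ (β - 1), by positivity, fun a b ha hb => ?_⟩
    rw [min_eq_right h1, Real.rpow_one]
    have h := (convex_Icc (0 : ℝ) 2).norm_image_sub_le_of_norm_hasDerivWithin_le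
      (f := fun x : ℝ => x ^ β) (f' := fun x => β * x ^ (β - 1)) (C := β * 2 ^ (β - 1))
      (fun x _ => (Real.hasDerivAt_rpow_const (Or.inr h1)).hasDerivWithinAt)
      (fun x hx => by
        rw [Real.norm_of_nonneg (mul_nonneg hβ.le (Real.rpow_nonneg hx.1 _))]
        exact mul_le_mul_of_nonneg_left (Real.rpow_le_rpow hx.1 hx.2 (by linarith)) hβ.le)
      (x := max b 0) (y := max a 0) ⟨le_max_right _ _, max_le hb zero_le_two⟩
      ⟨le_max_right _ _, max_le ha zero_le_two⟩
    exact h.trans (mul_le_mul_of_nonneg_left (abs_max_sub_max_le_abs a b 0) (by positivity))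

lemma hasDerivAt_max_rpow {p : ℝ} (hp : 1 < p) (x : ℝ) :
    HasDerivAt (fun y : ℝ => max y 0 ^ p) (p * max x 0 ^ (p - 1)) x := by
  rcases lt_trichotomy x 0 with hx | rfl | hx
  · rw [max_eq_right hx.le, Real.zero_rpow (by linarith), mul_zero]
    refine (hasDerivAt_const x (0 : ℝ)).congr_of_eventuallyEq ?_
    filter_upwards [Iio_mem_nhds hx] with y hy
    rw [max_eq_right (le_of_lt hy), Real.zero_rpow (by linarith)]
  · rw [← hasDerivWithinAt_univ, ← Iic_union_Ici (a := (0 : ℝ))]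
    refine HasDerivWithinAt.union ?_ ?_
    · rw [max_self, Real.zero_rpow (by linarith), mul_zero]
      refine (hasDerivWithinAt_const (0 : ℝ) _ (0 : ℝ)).congr (fun y hy => ?_) ?_
      · rw [max_eq_right hy, Real.zero_rpow (by linarith)]
      · rw [max_self, Real.zero_rpow (by linarith)]
    · rw [max_self]
      refine (Real.hasDerivAt_rpow_const (Or.inr hp.le)).hasDerivWithinAt.congr
        (fun y hy => ?_) ?_
      · rw [max_eq_left hy]
      · rw [max_self]
  · rw [max_eq_left hx.le]
    refine (Real.hasDerivAt_rpow_const (Or.inr hp.le)).congr_of_eventuallyEq ?_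
    filter_upwards [Ioi_mem_nhds hx] with y hy
    rw [max_eq_left (le_of_lt hy)]

/-- Second differences of the positive part raised to a power `p > 0` are of order `min p 2`. -/
lemma exists_abs_max_rpow_second_diff_le {p : ℝ} (hp : 0 < p) :
    ∃ C : ℝ, 0 ≤ C ∧ ∀ s t : ℝ, s ≤ 1 → |t| ≤ 1 →
      |max (s + t) 0 ^ p + max (s - t) 0 ^ p - 2 * max s 0 ^ p| ≤ C * |t| ^ min p 2 := by
  rcases le_or_gt p 1 with h1 | h1
  · obtain ⟨C, hC, h⟩ := exists_abs_max_rpow_sub_le hp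
    refine ⟨2 * C, by positivity, fun s t hs ht => ?_⟩
    rw [min_eq_left h1] at h
    rw [min_eq_left (by linarith)]
    have ht' := abs_le.1 ht
    have e1 := h (s + t) s (by linarith) (by linarith)
    have e2 := h (s - t) s (by linarith) (by linarith)
    rw [show s + t - s = t by ring] at e1
    rw [show s - t - s = -t by ring, abs_neg] at e2
    calc |max (s + t) 0 ^ p + max (s - t) 0 ^ p - 2 * max s 0 ^ p|
        = |(max (s + t) 0 ^ p - max s 0 ^ p) + (max (s - t) 0 ^ p - max s 0 ^ p)| := by
          congr 1; ring
      _ ≤ _ := (abs_add_le _ _).trans (by linarith)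
  · obtain ⟨C, hC, h⟩ := exists_abs_max_rpow_sub_le (sub_pos.2 h1)
    have hm0 : 0 < min (p - 1) 1 := lt_min (by linarith) one_pos
    have hm : min p 2 = min (p - 1) 1 + 1 := by
      rw [← min_add_add_right]; norm_num
    refine ⟨p * C * 2 ^ min (p - 1) 1, by positivity, ?_⟩
    have pos : ∀ s t : ℝ, s ≤ 1 → 0 < t → t ≤ 1 →
        |max (s + t) 0 ^ p + max (s - t) 0 ^ p - 2 * max s 0 ^ p| ≤
          p * C * 2 ^ min (p - 1) 1 * t ^ min p 2 := by
      intro s t hs ht ht1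
      have hd : ∀ r : ℝ, HasDerivAt (fun r => max (s + r) 0 ^ p + max (s - r) 0 ^ p)
          (p * max (s + r) 0 ^ (p - 1) - p * max (s - r) 0 ^ (p - 1)) r := by
        intro r
        have a1 := (hasDerivAt_max_rpow h1 (s + r)).comp_const_add s r
        have a2 := (hasDerivAt_max_rpow h1 (s - r)).comp_const_sub s r
        exact (a1.add a2).congr_deriv (by ring)
      obtain ⟨c, hc, hc'⟩ := exists_hasDerivAt_eq_slope _ _ ht
        (fun r _ => (hd r).continuousAt.continuousWithinAt) (fun r _ => hd r)
      have e : max (s + t) 0 ^ p + max (s - t) 0 ^ p - 2 * max s 0 ^ p =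
          t * (p * (max (s + c) 0 ^ (p - 1) - max (s - c) 0 ^ (p - 1))) := by
        rw [← mul_sub, eq_div_iff (by linarith), add_zero, sub_zero, sub_zero] at hc'
        linarith
      have b := h (s + c) (s - c) (by linarith [hc.2]) (by linarith [hc.1])
      rw [show s + c - (s - c) = 2 * c by ring, abs_of_pos (mul_pos two_pos hc.1),
        Real.mul_rpow zero_le_two hc.1.le] at b
      have b' : c ^ min (p - 1) 1 ≤ t ^ min (p - 1) 1 :=
        Real.rpow_le_rpow hc.1.le hc.2.le hm0.le
      rw [e, abs_mul, abs_mul, abs_of_pos ht, abs_of_pos hp, hm, Real.rpow_add_one ht.ne']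
      calc _ ≤ t * (p * (C * (2 ^ min (p - 1) 1 * t ^ min (p - 1) 1))) := by
            gcongr
            exact b.trans (by gcongr)
        _ = _ := by ring
    intro s t hs ht
    rcases lt_trichotomy t 0 with h0 | rfl | h0
    · have := pos s (-t) hs (by linarith) (by rwa [← abs_of_neg h0])
      rw [abs_of_neg h0]
      rwa [sub_neg_eq_add, ← sub_eq_add_neg, add_comm (max (s - t) 0 ^ p)] at this
    · rw [add_zero, sub_zero, ← two_mul, sub_self, abs_zero]
      positivity
    · have := pos s t hs h0 (by rwa [← abs_of_pos h0])
      rwa [abs_of_pos h0]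

lemma integrableOn_closedBall_norm_rpow {E : Type*} [NormedAddCommGroup E] [NormedSpace ℝ E]
    [FiniteDimensional ℝ E] [Nontrivial E] [MeasurableSpace E] [BorelSpace E]
    (μ : Measure E) [μ.IsAddHaarMeasure] {r : ℝ} (hr : -(Module.finrank ℝ E : ℝ) < r) (R : ℝ) :
    IntegrableOn (fun x : E => ‖x‖ ^ r) (Metric.closedBall 0 R) μ := by
  refine IntegrableOn.mono_set (t := Metric.ball 0 (|R| + 1)) ?_
    (Metric.closedBall_subset_ball (by linarith [le_abs_self R]))
  rw [integrableOn_fun_norm_addHaar μ (f := fun y : ℝ => y ^ r)]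
  have hn : 1 ≤ Module.finrank ℝ E := Module.finrank_pos
  have h := (intervalIntegral.integrableOn_Ioo_rpow_iff
    (s := (Module.finrank ℝ E : ℝ) - 1 + r) (by positivity : 0 < |R| + 1)).2 (by linarith)
  refine h.congr_fun (fun y hy => ?_) measurableSet_Ioo
  simp only [smul_eq_mul]
  rw [Real.rpow_add hy.1, ← Nat.cast_pred hn, Real.rpow_natCast]

/-- Symmetrised form of the truncated integral. -/
lemma pvIntTr_eq_integral_second_diff {d : ℕ} {α : ℝ} {u : EuclideanSpace ℝ (Fin d) → ℝ}
    (hu : Continuous u) (x : EuclideanSpace ℝ (Fin d)) {ε : ℝ} (hε : 0 < ε) :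
    pvIntTr d α u x ε = ∫ z : EuclideanSpace ℝ (Fin d),
      {z | ε < ‖z‖ ∧ ‖z‖ ≤ 1}.indicator
        (fun z => (u (x + z) + u (x - z) - 2 * u x) / ‖z‖ ^ ((d : ℝ) + α) / 2) z := by
  set A := {y : EuclideanSpace ℝ (Fin d) | ε < dist y x ∧ dist y x ≤ 1}
  set g := fun y => (u y - u x) / dist x y ^ ((d : ℝ) + α)
  have hA : MeasurableSet A :=
    (measurableSet_lt measurable_const (measurable_id.dist measurable_const)).inter
      (measurableSet_le (measurable_id.dist measurable_const) measurable_const)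
  have hg : IntegrableOn g A := by
    have hK : IsCompact ({y | ε ≤ dist y x} ∩ Metric.closedBall x 1) :=
      (isCompact_closedBall x 1).inter_left
        (isClosed_le continuous_const (by fun_prop))
    refine (ContinuousOn.integrableOn_compact hK ?_).mono_set
      (fun y hy => ⟨hy.1.le, hy.2⟩)
    have hpos : ∀ y ∈ {y | ε ≤ dist y x} ∩ Metric.closedBall x 1, dist x y ≠ 0 := by
      intro y hy
      rw [dist_comm]
      exact (hε.trans_le hy.1).ne'
    refine ContinuousOn.div (by fun_prop)
      (ContinuousOn.rpow_const (by fun_prop) fun y hy => Or.inl (hpos y hy)) fun y hy => ?_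
    exact (Real.rpow_pos_of_pos (lt_of_le_of_ne dist_nonneg (hpos y hy).symm) _).ne'
  have hF : Integrable (A.indicator g) := (integrable_indicator_iff hA).2 hg
  have e1 := integral_add_left_eq_self (μ := volume) (A.indicator g) x
  have e2 := integral_sub_left_eq_self (A.indicator g) volume x
  have e3 := integral_add (hF.comp_add_left x) (hF.comp_sub_left x)
  rw [e1, e2] at e3
  have e4 : pvIntTr d α u x ε = ((∫ y, A.indicator g y) + ∫ y, A.indicator g y) / 2 := by
    rw [add_self_div_two, integral_indicator hA]; rfl
  rw [e4, ← e3, ← integral_div]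
  congr 1
  ext z
  have m1 : x + z ∈ A ↔ z ∈ {z | ε < ‖z‖ ∧ ‖z‖ ≤ 1} := by simp [A]
  have m2 : x - z ∈ A ↔ z ∈ {z | ε < ‖z‖ ∧ ‖z‖ ≤ 1} := by simp [A, dist_eq_norm]
  by_cases hz : z ∈ {z : EuclideanSpace ℝ (Fin d) | ε < ‖z‖ ∧ ‖z‖ ≤ 1}
  · rw [indicator_of_mem (m1.2 hz), indicator_of_mem (m2.2 hz), indicator_of_mem hz]
    simp only [g, dist_self_add_right, dist_self_sub_right]
    ring
  · rw [indicator_of_notMem (mt m1.1 hz), indicator_of_notMem (mt m2.1 hz),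
      indicator_of_notMem hz]
    simp

/-- If second differences of `u` at `x` are `O(|z|^q)` with `q > α`, the truncated fractional
Laplacian exists at `x`, with a bound depending only on the implied constant. -/
lemma exists_tendsto_pvIntTr {d : ℕ} (hd : 1 ≤ d) {α q C : ℝ} (hq : α < q)
    {u : EuclideanSpace ℝ (Fin d) → ℝ} (hu : Continuous u) (x : EuclideanSpace ℝ (Fin d))
    (h : ∀ z : EuclideanSpace ℝ (Fin d), ‖z‖ ≤ 1 →
      |u (x + z) + u (x - z) - 2 * u x| ≤ C * ‖z‖ ^ q) :
    ∃ L : ℝ, Tendsto (pvIntTr d α u x) (nhdsWithin 0 (Ioi 0)) (nhds L) ∧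
      |L| ≤ ∫ z : EuclideanSpace ℝ (Fin d), (Metric.closedBall 0 1).indicator
        (fun z => C / 2 * ‖z‖ ^ (q - (d + α))) z := by
  have : NeZero d := ⟨by omega⟩
  set G := fun z : EuclideanSpace ℝ (Fin d) =>
    (u (x + z) + u (x - z) - 2 * u x) / ‖z‖ ^ ((d : ℝ) + α) / 2
  set B : EuclideanSpace ℝ (Fin d) → ℝ := (Metric.closedBall 0 1).indicator
    (fun z => C / 2 * ‖z‖ ^ (q - (d + α)))
  have hG0 : G 0 = 0 := by simp [G, two_mul]
  have hBint : Integrable B := by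
    refine (integrable_indicator_iff Metric.isClosed_closedBall.measurableSet).2 ?_
    refine (integrableOn_closedBall_norm_rpow volume ?_ 1).const_mul _
    rw [finrank_euclideanSpace_fin]
    linarith
  have hC : 0 ≤ C := by
    obtain ⟨z, hz⟩ := exists_norm_eq (EuclideanSpace ℝ (Fin d)) zero_le_one
    have hz' := h z hz.le
    rw [hz, Real.one_rpow, mul_one] at hz'
    exact (abs_nonneg _).trans hz'
  have hGB : ∀ z, ‖z‖ ≤ 1 → |G z| ≤ B z := by
    intro z hz
    simp only [B]
    rw [indicator_of_mem (by simpa using hz)]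
    rcases eq_or_ne z 0 with rfl | hz0
    · rw [hG0, abs_zero]
      positivity
    · have hn : 0 < ‖z‖ := norm_pos_iff.2 hz0
      simp only [G]
      rw [abs_div, abs_div, abs_of_pos (Real.rpow_pos_of_pos hn _), abs_two,
        Real.rpow_sub hn, ← mul_div_assoc, div_mul_eq_mul_div, div_right_comm]
      gcongr
      exact h z hz
  have hB0 : ∀ z, 0 ≤ B z := fun z => indicator_nonneg (fun z _ => by positivity) z
  have hind : ∀ (s : Set (EuclideanSpace ℝ (Fin d))), (∀ z ∈ s, ‖z‖ ≤ 1) →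
      ∀ z, ‖s.indicator G z‖ ≤ B z := by
    intro s hs z
    by_cases hz : z ∈ s
    · rw [indicator_of_mem hz]
      exact hGB z (hs z hz)
    · rw [indicator_of_notMem hz, norm_zero]
      exact hB0 z
  have hGm : Measurable G := by
    have := hu.measurable
    fun_prop
  refine ⟨∫ z, (Metric.closedBall 0 1).indicator G z, ?_, ?_⟩
  · refine Tendsto.congr' (f₁ := fun ε => ∫ z, {z | ε < ‖z‖ ∧ ‖z‖ ≤ 1}.indicator G z) ?_ ?_
    · filter_upwards [self_mem_nhdsWithin] with ε hε
      exact (pvIntTr_eq_integral_second_diff hu x hε).symm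
    · refine tendsto_integral_filter_of_dominated_convergence B ?_ ?_ hBint ?_
      · refine Eventually.of_forall fun ε => (hGm.indicator ?_).aestronglyMeasurable
        exact (measurableSet_lt measurable_const measurable_norm).inter
          (measurableSet_le measurable_norm measurable_const)
      · exact Eventually.of_forall fun ε => Eventually.of_forall (hind _ fun z hz => hz.2)
      · refine Eventually.of_forall fun z => ?_
        rcases eq_or_ne z 0 with rfl | hz0
        · simp [indicator_apply, hG0]
        · refine tendsto_const_nhds.congr' ?_
          filter_upwards [mem_nhdsWithin_of_mem_nhds (Iio_mem_nhds (norm_pos_iff.2 hz0))]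
            with ε (hε : ε < ‖z‖)
          classical
          simp [indicator_apply, hε]
  · exact norm_integral_le_of_norm_le hBint
      (Eventually.of_forall (hind _ fun z hz => by simpa using hz))

/-- For every `p > α` there exist `R_* ∈ (0,1)` and `C > 0` (depending only on p, d, α)
such that for every `x` with `0 < x₁ ≤ R_*`, the limit defining `Δ̂^{α/2} w_p(x)` exists
and `|Δ̂^{α/2} w_p(x)| ≤ C`, where `w_p(x) = (x₁⁺)^p`. -/
theorem statement4 (d : ℕ) (hd : 1 ≤ d) (α : ℝ) (hα : α ∈ Set.Ioo (0 : ℝ) 2)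
    (p : ℝ) (hp : α < p) :
    ∃ R ∈ Set.Ioo (0 : ℝ) 1, ∃ C : ℝ, 0 < C ∧
      ∀ x : EuclideanSpace ℝ (Fin d), 0 < x ⟨0, hd⟩ → x ⟨0, hd⟩ ≤ R →
        ∃ L : ℝ,
          Filter.Tendsto (pvIntTr d α (fun y => (max (y ⟨0, hd⟩) 0) ^ p) x)
            (nhdsWithin 0 (Set.Ioi 0)) (nhds L) ∧
          |fracConst d α * L| ≤ C := by
  have hp0 : 0 < p := hα.1.trans hp
  obtain ⟨C, hC, h⟩ := exists_abs_max_rpow_second_diff_le hp0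
  set M := ∫ z : EuclideanSpace ℝ (Fin d), (Metric.closedBall 0 1).indicator
    (fun z => C / 2 * ‖z‖ ^ (min p 2 - (d + α))) z
  have hM : 0 ≤ M :=
    integral_nonneg fun z => indicator_nonneg (fun z _ => by positivity) z
  refine ⟨1 / 2, by norm_num, |fracConst d α| * M + 1, by positivity, fun x _ hx => ?_⟩
  obtain ⟨L, hL, hLM⟩ := exists_tendsto_pvIntTr hd (lt_min hp hα.2) (C := C)
    (u := fun y => max (y ⟨0, hd⟩) 0 ^ p)
    (Continuous.rpow_const (by fun_prop) fun _ => Or.inr hp0.le) x (fun z hz => by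
      have hz0 : |z ⟨0, hd⟩| ≤ ‖z‖ := PiLp.norm_apply_le z ⟨0, hd⟩
      refine (h (x ⟨0, hd⟩) (z ⟨0, hd⟩) (by linarith) (hz0.trans hz)).trans ?_
      exact mul_le_mul_of_nonneg_left
        (Real.rpow_le_rpow (abs_nonneg _) hz0 (le_min hp0.le zero_le_two)) hC)
  refine ⟨L, hL, ?_⟩
  rw [abs_mul]
  linarith [mul_le_mul_of_nonneg_left hLM (abs_nonneg (fracConst d α))]
end
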